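/- arXiv:2202.02509 — 5 statements merged into one kernel-verified Lean document; each statement's English description precedes it below -/
import Mathlib

section
/- Let Ω ⊂ ℝ³ be a bounded convex region with nonempty interior and let x be a point of the frontier ∂Ω at which Ω admits a unique supporting hyperplane, i.e., there is exactly one unit vector u with ⟨y − x, u⟩ ≤ 0 for all y ∈ Ω (this holds at every boundary point when ∂Ω is smooth). Then lim_{r→0} |B(x, r) ∩ Ω| / ((4/3)·π·r³) = 1/2. -/
open MeasureTheory Metric Real Filter Topology
open scoped RealInnerProductSpace

section HalfSpace

variable {E : Type*} [NormedAddCommGroup E] [InnerProductSpace ℝ E]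

/-- If a convex set with nonempty interior has at most one outer unit normal `u` at a boundary
point `x`, then every ray from `x` pointing strictly into the supporting half-space eventually
(near `x`) stays in the interior. -/
theorem Convex.eventually_add_smul_mem_interior_of_unique_normal [CompleteSpace E]
    {s : Set E} (hs : Convex ℝ s) (hint : (interior s).Nonempty) {x u v : E}
    (hx : x ∈ frontier s)
    (huniq : ∀ w : E, ‖w‖ = 1 → (∀ y ∈ s, ⟪y - x, w⟫ ≤ 0) → w = u) (hv : ⟪v, u⟫ < 0) :
    ∀ᶠ r : ℝ in 𝓝[>] 0, x + r • v ∈ interior s := by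
  obtain ⟨t, ht, htv⟩ : ∃ t : ℝ, 0 ≤ t ∧ x + t • v ∈ interior s := by
    by_contra! hray
    have hconv : Convex ℝ ((fun t : ℝ => x + t • v) '' Set.Ici 0) := by
      have h : (fun t : ℝ => x + t • v) = AffineMap.lineMap (k := ℝ) x (x + v) := by
        ext t
        simp [AffineMap.lineMap_apply, add_comm]
      rw [h]
      exact (convex_Ici 0).affine_image _
    obtain ⟨f, c, hfs, hfray⟩ := geometric_hahn_banach_open hs.interior isOpen_interior hconv
      (Set.disjoint_left.2 <| by rintro _ hy ⟨t, ht, rfl⟩; exact hray t ht hy)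
    have hc_le (t : ℝ) (ht : 0 ≤ t) : c ≤ f (x + t • v) := hfray _ ⟨t, ht, rfl⟩
    have hle (y : E) (hy : y ∈ closure s) : f y ≤ c := by
      rw [← hs.closure_interior_eq_closure_of_nonempty_interior hint] at hy
      exact closure_minimal (fun a ha => (hfs a ha).le)
        (isClosed_le f.continuous continuous_const) hy
    have hfx : f x = c :=
      le_antisymm (hle x (frontier_subset_closure hx)) (by simpa using hc_le 0 le_rfl)
    set w := (InnerProductSpace.toDual ℝ E).symm f with hw
    have hfw (y : E) : f y = ⟪y, w⟫ := by
      rw [real_inner_comm, hw, InnerProductSpace.toDual_symm_apply]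
    have hw0 : w ≠ 0 := by
      intro h0
      obtain ⟨a, ha⟩ := hint
      have := hfs a ha
      rw [← hfx, hfw, hfw, h0] at this
      simp at this
    have hwpos : 0 < ‖w‖⁻¹ := inv_pos.2 (norm_pos_iff.2 hw0)
    have hwu : ‖w‖⁻¹ • w = u := by
      refine huniq _ (norm_smul_inv_norm hw0) fun y hy => ?_
      rw [inner_smul_right, inner_sub_left, ← hfw, ← hfw, hfx]
      exact mul_nonpos_of_nonneg_of_nonpos hwpos.le
        (sub_nonpos.2 (hle y (subset_closure hy)))
    have hv' := hc_le 1 zero_le_one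
    rw [one_smul, map_add, hfx, hfw] at hv'
    rw [← hwu, inner_smul_right] at hv
    nlinarith
  have ht0 : 0 < t := by
    refine ht.lt_of_ne' fun h => ?_
    rw [h, zero_smul, add_zero] at htv
    exact hx.2 htv
  filter_upwards [Ioc_mem_nhdsGT ht0] with r hr
  have := hs.add_smul_mem_interior' (frontier_subset_closure hx) htv (t := r / t)
    ⟨div_pos hr.1 ht0, (div_le_one ht0).2 hr.2⟩
  rwa [smul_smul, div_mul_cancel₀ _ ht0.ne'] at this

variable [FiniteDimensional ℝ E] [MeasurableSpace E] [BorelSpace E]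
  (μ : Measure E) [μ.IsAddHaarMeasure]

theorem MeasureTheory.Measure.addHaar_setOf_inner_eq_zero {u : E} (hu : u ≠ 0) :
    μ {v | ⟪v, u⟫ = 0} = 0 := by
  have h : {v | ⟪v, u⟫ = 0} = ((ℝ ∙ u)ᗮ : Submodule ℝ E) := by
    ext v
    simp [Submodule.mem_orthogonal_singleton_iff_inner_left]
  rw [h]
  refine Measure.addHaar_submodule μ _ fun htop => hu ?_
  have : u ∈ (ℝ ∙ u)ᗮ := htop ▸ Submodule.mem_top
  simpa [Submodule.mem_orthogonal_singleton_iff_inner_left] using this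

theorem MeasureTheory.Measure.two_mul_addHaar_closedBall_inter_halfSpace {u : E} (hu : u ≠ 0)
    (r : ℝ) : 2 * μ (closedBall 0 r ∩ {v | ⟪v, u⟫ < 0}) = μ (closedBall 0 r) := by
  have hmeas : MeasurableSet {v : E | ⟪v, u⟫ < 0} :=
    (isOpen_lt (by fun_prop) continuous_const).measurableSet
  have hneg : μ (closedBall 0 r \ {v | ⟪v, u⟫ < 0}) =
      μ (closedBall 0 r ∩ {v | ⟪v, u⟫ < 0}) := by
    rw [← Measure.measure_preimage_neg μ (closedBall 0 r ∩ {v | ⟪v, u⟫ < 0})]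
    refine measure_congr ?_
    have hae : ∀ᵐ v ∂μ, ⟪v, u⟫ ≠ 0 := by
      simpa [ae_iff] using Measure.addHaar_setOf_inner_eq_zero μ hu
    filter_upwards [hae] with v hv
    refine propext (and_congr ?_ ?_)
    · change v ∈ closedBall 0 r ↔ -v ∈ closedBall 0 r
      simp
    · change ¬ ⟪v, u⟫ < 0 ↔ ⟪-v, u⟫ < 0
      rw [inner_neg_left, neg_lt_zero, not_lt]
      exact ⟨fun h => h.lt_of_ne' hv, le_of_lt⟩
  rw [← measure_inter_add_sdiff (closedBall 0 r) hmeas, hneg, two_mul]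

theorem MeasureTheory.Measure.addHaar_closedBall_inter_eq (s : Set E) (x : E) {r : ℝ}
    (hr : 0 < r) :
    μ (closedBall x r ∩ s) = ENNReal.ofReal (r ^ Module.finrank ℝ E) *
      μ (closedBall 0 1 ∩ (fun v => x + r • v) ⁻¹' s) := by
  have h : closedBall 0 1 ∩ (fun v => x + r • v) ⁻¹' s =
      (r • ·) ⁻¹' ((x + ·) ⁻¹' (closedBall x r ∩ s)) := by
    ext v
    simp [norm_smul, abs_of_pos hr, hr]
  have hpos : 0 < r ^ Module.finrank ℝ E := by positivity
  rw [h, Measure.addHaar_preimage_smul μ hr.ne', measure_preimage_add, ← mul_assoc,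
    ← ENNReal.ofReal_mul hpos.le, abs_of_pos (inv_pos.2 hpos), mul_inv_cancel₀ hpos.ne',
    ENNReal.ofReal_one, one_mul]

/-- Blow-ups of a convex set at a boundary point with a unique outer unit normal converge in
measure on the unit ball to the supporting half-space. -/
theorem Convex.tendsto_addHaar_blowup_of_unique_normal {s : Set E} (hs : Convex ℝ s)
    (hint : (interior s).Nonempty) {x u : E} (hx : x ∈ frontier s) (hu : ‖u‖ = 1)
    (hsu : ∀ y ∈ s, ⟪y - x, u⟫ ≤ 0)
    (huniq : ∀ w : E, ‖w‖ = 1 → (∀ y ∈ s, ⟪y - x, w⟫ ≤ 0) → w = u) :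
    Tendsto (fun r : ℝ => μ (closedBall 0 1 ∩ (fun v => x + r • v) ⁻¹' interior s))
      (𝓝[>] 0) (𝓝 (μ (closedBall 0 1 ∩ {v | ⟪v, u⟫ < 0}))) := by
  have hu0 : u ≠ 0 := norm_ne_zero_iff.1 (by simp [hu])
  refine tendsto_measure_of_ae_tendsto_indicator _ ?_ (fun r => ?_)
    (measurableSet_closedBall (x := (0 : E)) (ε := 1)) measure_closedBall_lt_top.ne
    (Eventually.of_forall fun r => Set.inter_subset_left) ?_
  · exact measurableSet_closedBall.inter
      (isOpen_lt (by fun_prop) continuous_const).measurableSet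
  · exact measurableSet_closedBall.inter (isOpen_interior.preimage (by fun_prop)).measurableSet
  · have hae : ∀ᵐ v ∂μ, ⟪v, u⟫ ≠ 0 := by
      simpa [ae_iff] using Measure.addHaar_setOf_inner_eq_zero μ hu0
    filter_upwards [hae] with v hv
    rcases hv.lt_or_gt with hneg | hpos
    · filter_upwards [hs.eventually_add_smul_mem_interior_of_unique_normal hint hx huniq hneg]
        with r hr
      exact and_congr_right fun _ => ⟨fun _ => hneg, fun _ => hr⟩
    · filter_upwards [self_mem_nhdsWithin] with r hr
      refine and_congr_right fun _ => ⟨fun h => ?_, fun h => absurd h hpos.not_gt⟩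
      have h' := hsu _ (interior_subset h)
      rw [add_sub_cancel_left, real_inner_smul_left] at h'
      exact absurd h' (mul_pos hr hpos).not_ge

end HalfSpace

theorem ball_intersection_volume_boundary_limit
    (Ω : Set (EuclideanSpace ℝ (Fin 3)))
    (hconv : Convex ℝ Ω) (hbdd : Bornology.IsBounded Ω)
    (hint : (interior Ω).Nonempty)
    (x : EuclideanSpace ℝ (Fin 3)) (hx : x ∈ frontier Ω)
    (hsupp : ∃! u : EuclideanSpace ℝ (Fin 3),
      ‖u‖ = 1 ∧ ∀ y ∈ Ω, ⟪y - x, u⟫ ≤ 0) :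
    Tendsto (fun r : ℝ =>
        (volume (closedBall x r ∩ Ω)).toReal / ((4 / 3) * π * r ^ 3))
      (𝓝[>] 0) (𝓝 (1 / 2)) := by
  obtain ⟨u, ⟨hu, hsu⟩, huniq⟩ := hsupp
  have hu0 : u ≠ 0 := norm_ne_zero_iff.1 (by simp [hu])
  have hfin : volume (closedBall 0 1 ∩ {v : EuclideanSpace ℝ (Fin 3) | ⟪v, u⟫ < 0}) ≠ ⊤ :=
    measure_ne_top_of_subset Set.inter_subset_left measure_closedBall_lt_top.ne
  have hhalf : (volume (closedBall 0 1 ∩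
      {v : EuclideanSpace ℝ (Fin 3) | ⟪v, u⟫ < 0})).toReal / ((4 / 3) * π) = 1 / 2 := by
    have h := congrArg ENNReal.toReal
      (Measure.two_mul_addHaar_closedBall_inter_halfSpace volume hu0 1)
    rw [EuclideanSpace.volume_closedBall_fin_three, ENNReal.toReal_mul, ENNReal.toReal_mul,
      ENNReal.toReal_ofReal (by positivity)] at h
    simp only [ENNReal.toReal_ofNat, ENNReal.ofReal_one, one_pow, ENNReal.toReal_one] at h
    rw [div_eq_iff (by positivity)]
    linarith
  have hlim := (ENNReal.tendsto_toReal hfin).comp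
    (hconv.tendsto_addHaar_blowup_of_unique_normal volume hint hx hu hsu
      fun w hw hws => huniq w ⟨hw, hws⟩)
  rw [← hhalf]
  refine (hlim.div_const _).congr' ?_
  filter_upwards [self_mem_nhdsWithin] with r (hr : 0 < r)
  have hvol : volume (closedBall x r ∩ Ω) = volume (closedBall x r ∩ interior Ω) :=
    measure_congr <| (ae_eq_refl _).inter
      (interior_ae_eq_of_null_frontier (hconv.addHaar_frontier volume)).symm
  rw [hvol, Measure.addHaar_closedBall_inter_eq volume _ x hr, finrank_euclideanSpace_fin,
    ENNReal.toReal_mul, ENNReal.toReal_ofReal (by positivity), Function.comp_apply,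
    mul_comm (r ^ 3), mul_div_mul_right _ _ (by positivity)]
end

section
/- Fix an integer k ≥ 1 and a real constant ξ, and let r_n = ((16/(5π))·(log n + (3k/2 − 1)·log log n + ξ)/n)^{1/3}. For 0 ≤ t ≤ r let a(r, t) = (π/3)·(r − t)²·(2r + t), the volume of the spherical cap {x ∈ ℝ³ : ‖x‖ ≤ r, x₁ ≥ t}. Then lim_{n→∞} n·∫_0^{r_n/2} (n·a(r_n, t))^k · e^{−n·a(r_n, t)} / k! dt = (4/(3π))·e^{−2ξ/3}·(5π/16)^{2/3}·(2/3)^k·(1/k!). -/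
open MeasureTheory Metric Real Filter Topology

/-- The volume of the cap of the unit ball at height `1 / 2 - v`. -/
noncomputable def unitCap (v : ℝ) : ℝ := π / 3 * (1 / 2 + v) ^ 2 * (5 / 2 - v)

lemma continuous_unitCap : Continuous unitCap := by
  unfold unitCap
  fun_prop

lemma unitCap_zero : unitCap 0 = 5 * π / 24 := by
  unfold unitCap
  ring

lemma unitCap_sub (v : ℝ) :
    unitCap v - 5 * π / 24 = 3 * π / 4 * v + π / 3 * (v ^ 2 * (3 / 2 - v)) := by
  unfold unitCap
  ring

lemma unitCap_nonneg {v : ℝ} (hv' : v ≤ 1 / 2) : 0 ≤ unitCap v := by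
  have : 0 ≤ 5 / 2 - v := by linarith
  unfold unitCap
  positivity

lemma unitCap_le {v : ℝ} (hv : 0 ≤ v) (hv' : v ≤ 1 / 2) : unitCap v ≤ 5 * π / 6 := by
  have h1 : (1 / 2 + v) ^ 2 ≤ 1 := by nlinarith
  have h2 : (1 / 2 + v) ^ 2 * (5 / 2 - v) ≤ 1 * (5 / 2) :=
    mul_le_mul h1 (by linarith) (by linarith) (by norm_num)
  unfold unitCap
  nlinarith [pi_pos]

/-- Laplace asymptotics at the endpoint of the interval, in rescaled form. -/
lemma tendsto_integral_unitCap (k : ℕ) :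
    Tendsto (fun M : ℝ => ∫ u in (0 : ℝ)..(M / 2),
        unitCap (u / M) ^ k * exp (-(M * (unitCap (u / M) - 5 * π / 24))))
      atTop (𝓝 ((5 * π / 24) ^ k * (4 / (3 * π)))) := by
  set f : ℝ → ℝ → ℝ := fun M u =>
    unitCap (u / M) ^ k * exp (-(M * (unitCap (u / M) - 5 * π / 24))) with hf
  have hfc (M : ℝ) : Continuous (f M) := by
    have := continuous_unitCap
    fun_prop
  have hexp : IntegrableOn (fun u : ℝ => exp (-(3 * π / 4) * u)) (Set.Ioi 0) :=
    integrableOn_exp_mul_Ioi (by linarith [pi_pos]) 0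
  have hlim : Tendsto (fun M : ℝ => ∫ u in Set.Ioi (0 : ℝ), (Set.Ioc 0 (M / 2)).indicator (f M) u)
      atTop (𝓝 (∫ u in Set.Ioi (0 : ℝ), (5 * π / 24) ^ k * exp (-(3 * π / 4) * u))) := by
    refine tendsto_integral_filter_of_dominated_convergence
      (fun u => (5 * π / 6) ^ k * exp (-(3 * π / 4) * u)) ?_ ?_ (hexp.const_mul _) ?_
    · exact Eventually.of_forall fun M =>
        ((hfc M).aestronglyMeasurable.indicator measurableSet_Ioc)
    · filter_upwards [eventually_gt_atTop 0] with M hM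
      refine Eventually.of_forall fun u => ?_
      by_cases hu : u ∈ Set.Ioc 0 (M / 2)
      · have hv : 0 ≤ u / M := div_nonneg hu.1.le hM.le
        have hv' : u / M ≤ 1 / 2 := by
          rw [div_le_iff₀ hM]
          linarith [hu.2]
        have hcap := unitCap_nonneg hv'
        rw [Set.indicator_of_mem hu, norm_of_nonneg (by positivity)]
        refine mul_le_mul (pow_le_pow_left₀ hcap (unitCap_le hv hv') k) (exp_le_exp.2 ?_)
          (exp_pos _).le (by positivity)
        have h1 : M * (3 * π / 4 * (u / M)) = 3 * π / 4 * u := by field_simp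
        have h2 : 0 ≤ M * (π / 3 * ((u / M) ^ 2 * (3 / 2 - u / M))) := by
          have : 0 ≤ 3 / 2 - u / M := by linarith
          positivity
        rw [unitCap_sub, mul_add, h1]
        linarith
      · rw [Set.indicator_of_notMem hu, norm_zero]
        positivity
    · filter_upwards [ae_restrict_mem measurableSet_Ioi] with u hu
      have hdiv : Tendsto (fun M : ℝ => u / M) atTop (𝓝 0) := tendsto_const_nhds.div_atTop tendsto_id
      have hcap : Tendsto (fun M : ℝ => unitCap (u / M)) atTop (𝓝 (5 * π / 24)) := by
        rw [← unitCap_zero]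
        exact (continuous_unitCap.tendsto 0).comp hdiv
      have harg : Tendsto (fun M : ℝ => -(M * (unitCap (u / M) - 5 * π / 24))) atTop
          (𝓝 (-(3 * π / 4) * u)) := by
        have h : Tendsto (fun M : ℝ => -(3 * π / 4 * u + π / 3 * (u * (u / M) * (3 / 2 - u / M))))
            atTop (𝓝 (-(3 * π / 4 * u + π / 3 * (u * 0 * (3 / 2 - 0))))) :=
          (tendsto_const_nhds.add (((hdiv.const_mul u).mul (hdiv.const_sub _)).const_mul _)).neg
        refine (h.congr' ?_).trans_eq (by ring_nf)
        filter_upwards [eventually_gt_atTop 0] with M hM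
        rw [unitCap_sub]
        field_simp
      refine ((hcap.pow k).mul (harg.rexp)).congr' ?_
      filter_upwards [eventually_ge_atTop (2 * u)] with M hM
      rw [Set.indicator_of_mem (show u ∈ Set.Ioc 0 (M / 2) from ⟨hu, by linarith⟩)]
  have hval : ∫ u in Set.Ioi (0 : ℝ), (5 * π / 24) ^ k * exp (-(3 * π / 4) * u)
      = (5 * π / 24) ^ k * (4 / (3 * π)) := by
    rw [integral_const_mul, integral_exp_mul_Ioi (by linarith [pi_pos])]
    simp
  rw [hval] at hlim
  refine hlim.congr' ?_
  filter_upwards [eventually_ge_atTop 0] with M hM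
  rw [intervalIntegral.integral_of_le (by linarith), setIntegral_indicator measurableSet_Ioc,
    Set.inter_eq_right.2 Set.Ioc_subset_Ioi_self]

lemma tendsto_log_add_log_log_div_log (b ξ : ℝ) :
    Tendsto (fun n : ℕ => (log n + b * log (log n) + ξ) / log n) atTop (𝓝 1) := by
  have hlog : Tendsto (fun n : ℕ => log (n : ℝ)) atTop atTop :=
    tendsto_log_atTop.comp tendsto_natCast_atTop_atTop
  have h1 : Tendsto (fun n : ℕ => log (log (n : ℝ)) / log n) atTop (𝓝 0) :=
    isLittleO_log_id_atTop.tendsto_div_nhds_zero.comp hlog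
  have h2 : Tendsto (fun n : ℕ => ξ / log (n : ℝ)) atTop (𝓝 0) := tendsto_const_nhds.div_atTop hlog
  have h3 : Tendsto (fun n : ℕ => 1 + b * (log (log (n : ℝ)) / log n) + ξ / log (n : ℝ)) atTop
      (𝓝 (1 + b * 0 + 0)) := (tendsto_const_nhds.add (h1.const_mul b)).add h2
  refine (h3.congr' ?_).trans_eq (by simp)
  filter_upwards [hlog.eventually_gt_atTop 0] with n hn
  field_simp

/-- The cap integral after the substitution `t = ρ / 2 - u / (m * ρ ^ 2)`. -/
lemma mul_integral_cap_eq (k : ℕ) {m ρ : ℝ} (hm : 0 < m) (hρ : 0 < ρ) :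
    m * ∫ t in (0 : ℝ)..(ρ / 2), (m * (π / 3 * (ρ - t) ^ 2 * (2 * ρ + t))) ^ k *
        exp (-(m * (π / 3 * (ρ - t) ^ 2 * (2 * ρ + t)))) / (k.factorial : ℝ)
      = (ρ ^ 2)⁻¹ * (m * ρ ^ 3) ^ k * exp (-(5 * π / 24 * (m * ρ ^ 3))) / (k.factorial : ℝ) *
        ∫ u in (0 : ℝ)..(m * ρ ^ 3 / 2), unitCap (u / (m * ρ ^ 3)) ^ k *
          exp (-(m * ρ ^ 3 * (unitCap (u / (m * ρ ^ 3)) - 5 * π / 24))) := by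
  have hsub := intervalIntegral.integral_comp_sub_mul (a := 0) (b := m * ρ ^ 3 / 2)
    (fun t => (m * (π / 3 * (ρ - t) ^ 2 * (2 * ρ + t))) ^ k *
        exp (-(m * (π / 3 * (ρ - t) ^ 2 * (2 * ρ + t)))) / (k.factorial : ℝ))
    (c := (m * ρ ^ 2)⁻¹) (by positivity) (ρ / 2)
  have e1 : ρ / 2 - (m * ρ ^ 2)⁻¹ * (m * ρ ^ 3 / 2) = 0 := by field_simp; ring
  rw [e1, mul_zero, sub_zero, inv_inv, smul_eq_mul] at hsub
  have e2 (I J : ℝ) (h : J = m * ρ ^ 2 * I) : m * I = (ρ ^ 2)⁻¹ * J := by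
    rw [h]; field_simp
  rw [e2 _ _ hsub, mul_assoc (ρ ^ 2)⁻¹ (_ ^ k), mul_div_assoc (ρ ^ 2)⁻¹, mul_assoc (ρ ^ 2)⁻¹]
  congr 1
  rw [← intervalIntegral.integral_const_mul]
  refine intervalIntegral.integral_congr fun u _ => ?_
  have e3 : m * (π / 3 * (ρ - (ρ / 2 - (m * ρ ^ 2)⁻¹ * u)) ^ 2 *
      (2 * ρ + (ρ / 2 - (m * ρ ^ 2)⁻¹ * u))) = m * ρ ^ 3 * unitCap (u / (m * ρ ^ 3)) := by
    unfold unitCap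
    field_simp
    ring
  have e4 : exp (-(m * ρ ^ 3 * unitCap (u / (m * ρ ^ 3)))) = exp (-(5 * π / 24 * (m * ρ ^ 3))) *
      exp (-(m * ρ ^ 3 * (unitCap (u / (m * ρ ^ 3)) - 5 * π / 24))) := by
    rw [← exp_add]
    ring_nf
  simp only [e3]
  rw [e4, mul_pow]
  ring

/-- The prefactor produced by the radius `(M / m) ^ (1 / 3)` with `M = 16 / (5 * π) * L`. -/
lemma cap_prefactor_eq (k : ℕ) {m ρ L ξ : ℝ} (hlog : 0 < log m) (hm : 0 < m)
    (hL : L = log m + (3 * (k : ℝ) / 2 - 1) * log (log m) + ξ) (hL0 : 0 < L)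
    (hρ : ρ = (16 / (5 * π) * L / m) ^ ((1 : ℝ) / 3)) :
    (ρ ^ 2)⁻¹ * (16 / (5 * π) * L) ^ k * exp (-(5 * π / 24 * (16 / (5 * π) * L)))
      = (5 * π / 16) ^ ((2 : ℝ) / 3) * (16 / (5 * π)) ^ k * exp (-(2 * ξ) / 3) *
        (L / log m) ^ ((k : ℝ) - 2 / 3) := by
  have hπ := pi_pos
  have h1 : (ρ ^ 2)⁻¹ = (5 * π / 16) ^ ((2 : ℝ) / 3) * (m ^ ((2 : ℝ) / 3) / L ^ ((2 : ℝ) / 3)) := by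
    rw [hρ, ← rpow_natCast, ← rpow_mul (by positivity), ← inv_rpow (by positivity),
      ← div_rpow hm.le hL0.le, ← mul_rpow (by positivity) (by positivity)]
    congr 1
    · field_simp
    · norm_num
  have h2 : exp (-(5 * π / 24 * (16 / (5 * π) * L))) =
      exp (-(2 * ξ) / 3) / (m ^ ((2 : ℝ) / 3) * log m ^ ((k : ℝ) - 2 / 3)) := by
    rw [rpow_def_of_pos hm, rpow_def_of_pos hlog, ← exp_add, ← exp_sub, hL]
    congr 1
    field_simp
    ring
  have h3 : L ^ ((k : ℝ) - 2 / 3) = L ^ k / L ^ ((2 : ℝ) / 3) := by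
    rw [rpow_sub hL0, rpow_natCast]
  rw [h1, h2, div_rpow hL0.le hlog.le, h3, mul_pow]
  field_simp

theorem cap_volume_integral_limit
    (k : ℕ) (hk : 1 ≤ k) (ξ : ℝ)
    (r : ℕ → ℝ)
    (hr : ∀ n : ℕ, r n = ((16 / (5 * π)) *
        (Real.log n + ((3 * (k : ℝ)) / 2 - 1) * Real.log (Real.log n) + ξ) / n)
        ^ ((1 : ℝ) / 3))
    (a : ℝ → ℝ → ℝ)
    (ha : ∀ ρ t : ℝ, a ρ t = (π / 3) * (ρ - t) ^ 2 * (2 * ρ + t)) :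
    Tendsto (fun n : ℕ =>
        (n : ℝ) * ∫ t in (0 : ℝ)..(r n / 2),
          ((n : ℝ) * a (r n) t) ^ k * Real.exp (-((n : ℝ) * a (r n) t)) /
            (k.factorial : ℝ))
      atTop
      (𝓝 ((4 / (3 * π)) * Real.exp (-(2 * ξ) / 3) * (5 * π / 16) ^ ((2 : ℝ) / 3) *
        ((2 : ℝ) / 3) ^ k * (1 / (k.factorial : ℝ)))) := by
  have hπ := pi_pos
  have hlog : Tendsto (fun n : ℕ => log (n : ℝ)) atTop atTop :=
    tendsto_log_atTop.comp tendsto_natCast_atTop_atTop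
  set L : ℕ → ℝ := fun n => log n + (3 * (k : ℝ) / 2 - 1) * log (log n) + ξ with hL
  have hratio : Tendsto (fun n => L n / log n) atTop (𝓝 1) :=
    tendsto_log_add_log_log_div_log _ ξ
  have hLtop : Tendsto L atTop atTop := by
    refine (hratio.pos_mul_atTop one_pos hlog).congr' ?_
    filter_upwards [hlog.eventually_gt_atTop 0] with n hn
    field_simp
  have hJ := (tendsto_integral_unitCap k).comp
    (hLtop.const_mul_atTop (show 0 < 16 / (5 * π) by positivity))
  have hpow : Tendsto (fun n => (L n / log n) ^ ((k : ℝ) - 2 / 3)) atTop (𝓝 1) := by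
    simpa using hratio.rpow_const (p := (k : ℝ) - 2 / 3) (Or.inl one_ne_zero)
  have hprod := ((hpow.const_mul ((5 * π / 16) ^ ((2 : ℝ) / 3) * (16 / (5 * π)) ^ k *
    exp (-(2 * ξ) / 3))).div_const (k.factorial : ℝ)).mul hJ
  have hconst : ((2 : ℝ) / 3) ^ k = (16 / (5 * π)) ^ k * (5 * π / 24) ^ k := by
    rw [← mul_pow]
    congr 1
    field_simp
    norm_num
  refine (hprod.congr' ?_).trans_eq (by rw [hconst]; ring_nf)
  filter_upwards [hlog.eventually_gt_atTop 0, hLtop.eventually_gt_atTop 0,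
    eventually_gt_atTop 0] with n hlogn hLn hn
  have hn' : (0 : ℝ) < n := Nat.cast_pos.2 hn
  have hM : 0 < 16 / (5 * π) * L n / n := by positivity
  have hρ : r n = (16 / (5 * π) * L n / n) ^ ((1 : ℝ) / 3) := hr n
  have hρ0 : 0 < r n := hρ ▸ rpow_pos_of_pos hM _
  have hcube : (n : ℝ) * r n ^ 3 = 16 / (5 * π) * L n := by
    rw [hρ, ← rpow_natCast, ← rpow_mul hM.le]
    norm_num
    field_simp
  simp only [ha, Function.comp_apply]
  rw [mul_integral_cap_eq k hn' hρ0, hcube, cap_prefactor_eq k hlogn hn' rfl hLn hρ]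
end

section
/- Let Ω ⊂ ℝ³ be a compact convex region of unit volume with nonempty interior, k ≥ 1 an integer, ξ a real constant, and r_n = ((16/(5π))·(log n + (3k/2 − 1)·log log n + ξ)/n)^{1/3}. Let Ω(0) = {x ∈ Ω : dist(x, ∂Ω) ≥ r_n}. Then n·∫_{Ω(0)} (n·|B(x, r_n) ∩ Ω|)^k · e^{−n·|B(x, r_n) ∩ Ω|} / k! dx → 0 as n → ∞. -/
open MeasureTheory Metric Real Filter Topology

theorem closedBall_subset_of_le_infDist_frontier {E : Type*} [NormedAddCommGroup E]
    [NormedSpace ℝ E] {s : Set E} (hs : IsClosed s) {x : E} (hx : x ∈ s) {ρ : ℝ} (hρ : 0 < ρ)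
    (h : ρ ≤ infDist x (frontier s)) : closedBall x ρ ⊆ s := by
  rw [← closure_ball x hρ.ne']
  refine closure_minimal ?_ hs
  by_contra hsub
  obtain ⟨y, hy, hys⟩ := Set.not_subset.1 hsub
  have hdisj : Disjoint (ball x ρ) (frontier s) :=
    disjoint_ball_infDist.mono_left (ball_subset_ball h)
  have hmem : ∀ z ∈ ball x ρ, z ∈ s → z ∈ interior s := fun z hz hzs => by
    by_contra hzi
    exact Set.disjoint_left.1 hdisj hz (hs.frontier_eq ▸ ⟨hzs, hzi⟩)
  have hxb := mem_ball_self (x := x) hρ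
  obtain ⟨z, -, hzi, hzs⟩ := (convex_ball x ρ).isPreconnected (interior s) sᶜ isOpen_interior
    hs.isOpen_compl (fun z hz => or_iff_not_imp_right.2 fun hzs => hmem z hz (not_not.1 hzs))
    ⟨x, hxb, hmem x hxb hx⟩ ⟨y, hy, hys⟩
  exact hzs (interior_subset hzi)

theorem tendsto_log_natCast_atTop : Tendsto (fun n : ℕ => Real.log n) atTop atTop :=
  Real.tendsto_log_atTop.comp tendsto_natCast_atTop_atTop

theorem eventually_mul_log_le_log_add_mul_log_log_add {a : ℝ} (ha : a < 1) (b ξ : ℝ) :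
    ∀ᶠ n : ℕ in atTop, a * Real.log n ≤ Real.log n + b * Real.log (Real.log n) + ξ := by
  have hlo : (fun t : ℝ => b * Real.log t + ξ) =o[atTop] (fun t : ℝ => t) :=
    (Real.isLittleO_log_id_atTop.const_mul_left b).add
      (Asymptotics.isLittleO_const_id_atTop ξ)
  have hev := hlo.bound (sub_pos.2 ha)
  filter_upwards [tendsto_log_natCast_atTop.eventually hev,
    tendsto_log_natCast_atTop.eventually_ge_atTop 0] with n hn h0
  rw [Real.norm_eq_abs, Real.norm_of_nonneg h0] at hn
  linarith [(abs_le.1 hn).1]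

theorem volume_real_closedBall_rpow_one_third (x : EuclideanSpace ℝ (Fin 3)) {v : ℝ}
    (hv : 0 ≤ v) :
    (volume (closedBall x (v ^ ((1 : ℝ) / 3)))).toReal = v * (π * 4 / 3) := by
  have hpow : (v ^ ((1 : ℝ) / 3)) ^ 3 = v := by
    rw [← Real.rpow_natCast, ← Real.rpow_mul hv]
    norm_num
  rw [EuclideanSpace.volume_closedBall_fin_three, ENNReal.toReal_mul, ENNReal.toReal_pow,
    ENNReal.toReal_ofReal (by positivity), ENNReal.toReal_ofReal (by positivity), hpow]

theorem interior_region_integral_vanishes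
    (Ω : Set (EuclideanSpace ℝ (Fin 3)))
    (hconv : Convex ℝ Ω) (hcomp : IsCompact Ω) (hint : (interior Ω).Nonempty)
    (hvol : volume Ω = 1)
    (k : ℕ) (hk : 1 ≤ k) (ξ : ℝ)
    (r : ℕ → ℝ)
    (hr : ∀ n : ℕ, r n = ((16 / (5 * π)) *
        (Real.log n + ((3 * (k : ℝ)) / 2 - 1) * Real.log (Real.log n) + ξ) / n)
        ^ ((1 : ℝ) / 3)) :
    Tendsto (fun n : ℕ =>
        (n : ℝ) * ∫ x in {x ∈ Ω | r n ≤ infDist x (frontier Ω)},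
          ((n : ℝ) * (volume (closedBall x (r n) ∩ Ω)).toReal) ^ k *
            Real.exp (-((n : ℝ) * (volume (closedBall x (r n) ∩ Ω)).toReal)) /
              (k.factorial : ℝ))
      atTop (𝓝 0) := by
  set L : ℕ → ℝ := fun n =>
    Real.log n + ((3 * (k : ℝ)) / 2 - 1) * Real.log (Real.log n) + ξ with hL
  have hlogL : ∀ᶠ n : ℕ in atTop, 15 / 32 * Real.log n ≤ L n :=
    eventually_mul_log_le_log_add_mul_log_log_add (by norm_num) _ _
  have hLtop : Tendsto L atTop atTop :=
    tendsto_atTop_mono' _ hlogL (tendsto_log_natCast_atTop.const_mul_atTop (by norm_num))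
  have hlim : Tendsto (fun n : ℕ => (64 / 15 * L n) ^ k * Real.exp (-(1 / 2) * (64 / 15 * L n)))
      atTop (𝓝 0) := by
    have h := tendsto_rpow_mul_exp_neg_mul_atTop_nhds_zero k (1 / 2) (by norm_num)
    simp only [Real.rpow_natCast] at h
    exact h.comp (hLtop.const_mul_atTop (by norm_num : (0 : ℝ) < 64 / 15))
  refine squeeze_zero_norm' ?_ hlim
  filter_upwards [hlogL, hLtop.eventually_gt_atTop 0, eventually_gt_atTop 0] with n hn hL0 hn0
  have hn0' : (0 : ℝ) < n := Nat.cast_pos.2 hn0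
  have hrn : r n = (16 / (5 * π) * L n / n) ^ ((1 : ℝ) / 3) := hr n
  have hv : 0 < 16 / (5 * π) * L n / n := by positivity
  have hr0 : 0 < r n := hrn ▸ Real.rpow_pos_of_pos hv _
  have hball : ∀ x ∈ {x ∈ Ω | r n ≤ infDist x (frontier Ω)},
      (n : ℝ) * (volume (closedBall x (r n) ∩ Ω)).toReal = 64 / 15 * L n := by
    rintro x ⟨hx, hxr⟩
    rw [Set.inter_eq_left.2
      (closedBall_subset_of_le_infDist_frontier hcomp.isClosed hx hr0 hxr), hrn,
      volume_real_closedBall_rpow_one_third x hv.le]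
    field_simp
    norm_num
  set u : ℝ := 64 / 15 * L n with hu
  have hu0 : 0 < u := by positivity
  have hSle : volume {x ∈ Ω | r n ≤ infDist x (frontier Ω)} ≤ 1 :=
    hvol ▸ measure_mono (Set.sep_subset _ _)
  have hSreal : volume.real {x ∈ Ω | r n ≤ infDist x (frontier Ω)} ≤ 1 :=
    ENNReal.toReal_le_of_le_ofReal zero_le_one (by simpa using hSle)
  have hint_le := norm_setIntegral_le_of_norm_le_const (μ := volume)
    (f := fun x => ((n : ℝ) * (volume (closedBall x (r n) ∩ Ω)).toReal) ^ k *
      Real.exp (-((n : ℝ) * (volume (closedBall x (r n) ∩ Ω)).toReal)) / (k.factorial : ℝ))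
    (C := u ^ k * Real.exp (-u)) (hSle.trans_lt ENNReal.one_lt_top) (by
      intro x hx
      rw [hball x hx, Real.norm_of_nonneg (by positivity)]
      exact div_le_self (by positivity) (mod_cast k.factorial_pos))
  have hn_exp : (n : ℝ) ≤ Real.exp (1 / 2 * u) := by
    rw [← Real.log_le_iff_le_exp hn0']
    linarith
  rw [norm_mul, Real.norm_of_nonneg hn0'.le]
  calc _ ≤ Real.exp (1 / 2 * u) * (u ^ k * Real.exp (-u)) := by
        refine mul_le_mul hn_exp (hint_le.trans ?_) (norm_nonneg _) (Real.exp_pos _).le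
        exact mul_le_of_le_one_right (by positivity) hSreal
    _ = u ^ k * Real.exp (-(1 / 2) * u) := by
        rw [mul_left_comm, ← Real.exp_add]
        ring_nf
end

section
/- Let Ω ⊂ ℝ³ be a compact convex region of unit volume with nonempty interior, k ≥ 1 an integer, ξ a real constant, G > 0 any constant, and r_n = ((16/(5π))·(log n + (3k/2 − 1)·log log n + ξ)/n)^{1/3}. Let Ω(2) = {x ∈ Ω : dist(x, ∂Ω) ≤ (G + 1)·r_n²}. Then n·∫_{Ω(2)} (n·|B(x, r_n) ∩ Ω|)^k · e^{−n·|B(x, r_n) ∩ Ω|} / k! dx → 0 as n → ∞. -/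
open MeasureTheory Metric Real Filter Topology

theorem volume_prod_le_of_fst_dist_le {β : Type*} [MeasureSpace β] [SFinite (volume : Measure β)]
    {A : Set (ℝ × β)} (hA : MeasurableSet A) {D : ℝ} {c : ENNReal}
    (hD : ∀ p ∈ A, ∀ q ∈ A, |p.1 - q.1| ≤ D)
    (hc : ∀ a, volume (Prod.mk a ⁻¹' A) ≤ c) : volume A ≤ ENNReal.ofReal D * c := by
  rw [Measure.volume_eq_prod, Measure.prod_apply hA]
  have hP : volume (Prod.fst '' A) ≤ ENNReal.ofReal D := by
    refine (Real.volume_le_diam _).trans (ediam_le_of_forall_dist_le ?_)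
    rintro _ ⟨p, hp, rfl⟩ _ ⟨q, hq, rfl⟩
    rw [Real.dist_eq]
    exact hD p hp q hq
  calc ∫⁻ a, volume (Prod.mk a ⁻¹' A)
      ≤ ∫⁻ a, (toMeasurable volume (Prod.fst '' A)).indicator (fun _ => c) a := by
        refine lintegral_mono fun a => ?_
        by_cases ha : a ∈ toMeasurable volume (Prod.fst '' A)
        · simpa [ha] using hc a
        · have : Prod.mk a ⁻¹' A = ∅ := by
            ext y
            simp only [Set.mem_preimage, Set.mem_empty_iff_false, iff_false]
            exact fun hy => ha (subset_toMeasurable _ _ ⟨_, hy, rfl⟩)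
          simp [this]
    _ = c * volume (Prod.fst '' A) := by
        rw [lintegral_indicator_const (measurableSet_toMeasurable _ _), measure_toMeasurable]
    _ ≤ ENNReal.ofReal D * c := by
        rw [mul_comm]
        gcongr

theorem volume_le_of_coord_dist_le (b : OrthonormalBasis (Fin 3) ℝ (EuclideanSpace ℝ (Fin 3)))
    {B : Set (EuclideanSpace ℝ (Fin 3))} (hB : MeasurableSet B) {D h t : ℝ}
    (hD : ∀ x ∈ B, ∀ y ∈ B, |inner ℝ (b 0) (x - y)| ≤ D)
    (hh : ∀ x ∈ B, ∀ y ∈ B, inner ℝ (b 0) (x - y) = 0 → |inner ℝ (b 1) (x - y)| ≤ h)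
    (ht : ∀ x ∈ B, ∀ y ∈ B, inner ℝ (b 0) (x - y) = 0 → inner ℝ (b 1) (x - y) = 0 →
      |inner ℝ (b 2) (x - y)| ≤ t) :
    volume B ≤ ENNReal.ofReal D * (ENNReal.ofReal h * ENNReal.ofReal t) := by
  let e₁ : EuclideanSpace ℝ (Fin 3) ≃ᵐ (Fin 3 → ℝ) :=
    b.measurableEquiv.trans (MeasurableEquiv.toLp 2 (Fin 3 → ℝ)).symm
  let e₂ : (Fin 3 → ℝ) ≃ᵐ ℝ × (Fin 2 → ℝ) := MeasurableEquiv.piFinSuccAbove (fun _ => ℝ) 0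
  let e₃ : ℝ × (Fin 2 → ℝ) ≃ᵐ ℝ × (ℝ × ℝ) :=
    (MeasurableEquiv.refl ℝ).prodCongr (MeasurableEquiv.piFinTwo fun _ => ℝ)
  let e : EuclideanSpace ℝ (Fin 3) ≃ᵐ ℝ × (ℝ × ℝ) := (e₁.trans e₂).trans e₃
  have he : MeasurePreserving e volume volume := by
    refine MeasurePreserving.trans (MeasurePreserving.trans
      (b.measurePreserving_measurableEquiv.trans
        (EuclideanSpace.volume_preserving_symm_measurableEquiv_toLp _))
      (volume_preserving_piFinSuccAbove (fun _ => ℝ) 0)) ?_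
    exact (MeasurePreserving.id volume).prod (volume_preserving_piFinTwo fun _ => ℝ)
  have hev : ∀ x, e x = (inner ℝ (b 0) x, inner ℝ (b 1) x, inner ℝ (b 2) x) := by
    intro x
    simp only [← b.repr_apply_apply]
    rfl
  rw [← he.symm.measure_preimage_equiv B]
  have hmem : ∀ p : ℝ × (ℝ × ℝ), p ∈ e.symm ⁻¹' B → ∃ x ∈ B,
      p = (inner ℝ (b 0) x, inner ℝ (b 1) x, inner ℝ (b 2) x) := by
    intro p hp
    exact ⟨e.symm p, hp, by rw [← hev, e.apply_symm_apply]⟩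
  have hm := e.symm.measurable hB
  refine volume_prod_le_of_fst_dist_le hm ?_ fun u => ?_
  · intro p hp q hq
    obtain ⟨x, hx, rfl⟩ := hmem p hp
    obtain ⟨y, hy, rfl⟩ := hmem q hq
    simpa [inner_sub_right] using hD x hx y hy
  refine volume_prod_le_of_fst_dist_le (measurable_prodMk_left hm) ?_ fun v => ?_
  · intro p hp q hq
    obtain ⟨x, hx, hx'⟩ := hmem _ hp
    obtain ⟨y, hy, hy'⟩ := hmem _ hq
    simp only [Prod.ext_iff] at hx' hy'
    have := hh x hx y hy (by rw [inner_sub_right, ← hx'.1, ← hy'.1, sub_self])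
    rwa [inner_sub_right, ← hx'.2.1, ← hy'.2.1] at this
  refine (Real.volume_le_diam _).trans (ediam_le_of_forall_dist_le ?_)
  intro p hp q hq
  obtain ⟨x, hx, hx'⟩ := hmem _ hp
  obtain ⟨y, hy, hy'⟩ := hmem _ hq
  simp only [Prod.mk.injEq] at hx' hy'
  have := ht x hx y hy (by rw [inner_sub_right, ← hx'.1, ← hy'.1, sub_self])
    (by rw [inner_sub_right, ← hx'.2.1, ← hy'.2.1, sub_self])
  rwa [inner_sub_right, ← hx'.2.2, ← hy'.2.2] at this

/-- The points of `Ω` where `e` is, up to a slope `δ` and a gap `η`, an outward normal to `Ω`. -/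
def almostSupported (Ω : Set (EuclideanSpace ℝ (Fin 3))) (e : EuclideanSpace ℝ (Fin 3))
    (δ η : ℝ) : Set (EuclideanSpace ℝ (Fin 3)) :=
  {x ∈ Ω | ∀ z ∈ Ω, inner ℝ e (z - x) ≤ η + δ * ‖z - x‖}

/-- The points of `almostSupported Ω e δ η` whose translate by `p` is further than `s`
from `Ω`. -/
def shiftFar (Ω : Set (EuclideanSpace ℝ (Fin 3))) (e : EuclideanSpace ℝ (Fin 3)) (δ η : ℝ)
    (p : EuclideanSpace ℝ (Fin 3)) (s : ℝ) : Set (EuclideanSpace ℝ (Fin 3)) :=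
  {x ∈ almostSupported Ω e δ η | s < infDist (x + p) Ω}

theorem isClosed_almostSupported {Ω : Set (EuclideanSpace ℝ (Fin 3))} (hΩ : IsClosed Ω)
    (e : EuclideanSpace ℝ (Fin 3)) (δ η : ℝ) : IsClosed (almostSupported Ω e δ η) := by
  have : almostSupported Ω e δ η =
      Ω ∩ ⋂ z ∈ Ω, {x | inner ℝ e (z - x) ≤ η + δ * ‖z - x‖} := by
    ext x
    simp [almostSupported]
  rw [this]
  refine hΩ.inter (isClosed_biInter fun z _ => isClosed_le ?_ ?_) <;> fun_prop

theorem measurableSet_shiftFar {Ω : Set (EuclideanSpace ℝ (Fin 3))} (hΩ : IsClosed Ω)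
    (e : EuclideanSpace ℝ (Fin 3)) (δ η : ℝ) (p : EuclideanSpace ℝ (Fin 3)) (s : ℝ) :
    MeasurableSet (shiftFar Ω e δ η p s) := by
  refine (isClosed_almostSupported hΩ e δ η).measurableSet.inter (IsOpen.measurableSet ?_)
  exact isOpen_lt continuous_const
    ((continuous_infDist_pt Ω).comp (continuous_id.add continuous_const))

theorem norm_le_sum_abs_coord (b : OrthonormalBasis (Fin 3) ℝ (EuclideanSpace ℝ (Fin 3)))
    (x : EuclideanSpace ℝ (Fin 3)) :
    ‖x‖ ≤ |inner ℝ (b 0) x| + |inner ℝ (b 1) x| + |inner ℝ (b 2) x| := by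
  have h := b.sum_repr' x
  rw [Fin.sum_univ_three] at h
  calc ‖x‖ = ‖inner ℝ (b 0) x • b 0 + inner ℝ (b 1) x • b 1 + inner ℝ (b 2) x • b 2‖ := by
        rw [h]
    _ ≤ _ := norm_add₃_le
    _ = _ := by simp [norm_smul]

theorem abs_coord_le_norm (b : OrthonormalBasis (Fin 3) ℝ (EuclideanSpace ℝ (Fin 3)))
    (i : Fin 3) (x : EuclideanSpace ℝ (Fin 3)) : |inner ℝ (b i) x| ≤ ‖x‖ := by
  simpa using abs_real_inner_le_norm (b i) x

theorem inner_eq_coord_sum (b : OrthonormalBasis (Fin 3) ℝ (EuclideanSpace ℝ (Fin 3)))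
    (x y : EuclideanSpace ℝ (Fin 3)) :
    inner ℝ x y = inner ℝ (b 0) x * inner ℝ (b 0) y + inner ℝ (b 1) x * inner ℝ (b 1) y +
      inner ℝ (b 2) x * inner ℝ (b 2) y := by
  rw [← b.sum_inner_mul_inner x y, Fin.sum_univ_three]
  simp only [real_inner_comm]

theorem abs_normal_coord_le (b : OrthonormalBasis (Fin 3) ℝ (EuclideanSpace ℝ (Fin 3)))
    {Ω : Set (EuclideanSpace ℝ (Fin 3))} {δ η : ℝ} (hδ : 0 ≤ δ) (hδ' : δ ≤ 1 / 2)
    {x y : EuclideanSpace ℝ (Fin 3)}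
    (hx : x ∈ almostSupported Ω (b 2) δ η) (hy : y ∈ almostSupported Ω (b 2) δ η) :
    |inner ℝ (b 2) (x - y)| ≤
      2 * η + 2 * δ * (|inner ℝ (b 0) (x - y)| + |inner ℝ (b 1) (x - y)|) := by
  have h₁ := hx.2 y hy.1
  have h₂ := hy.2 x hx.1
  rw [← neg_sub x y, inner_neg_right, norm_neg] at h₁
  have h₃ := norm_le_sum_abs_coord b (x - y)
  have h₄ : |inner ℝ (b 2) (x - y)| ≤ η + δ * ‖x - y‖ := abs_le.2 ⟨by linarith, h₂⟩
  nlinarith [mul_le_mul_of_nonneg_left h₃ hδ, abs_nonneg (inner ℝ (b 2) (x - y))]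

theorem volume_almostSupported_le (b : OrthonormalBasis (Fin 3) ℝ (EuclideanSpace ℝ (Fin 3)))
    {Ω : Set (EuclideanSpace ℝ (Fin 3))} (hΩ : IsClosed Ω) {D δ η : ℝ} (hδ : 0 ≤ δ)
    (hδ' : δ ≤ 1 / 2) (hD : ∀ x ∈ Ω, ∀ y ∈ Ω, ‖x - y‖ ≤ D) :
    volume (almostSupported Ω (b 2) δ η) ≤
      ENNReal.ofReal D * (ENNReal.ofReal D * ENNReal.ofReal (2 * η)) := by
  refine volume_le_of_coord_dist_le b (isClosed_almostSupported hΩ _ _ _).measurableSet ?_ ?_ ?_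
  · exact fun x hx y hy => (abs_coord_le_norm b 0 _).trans (hD x hx.1 y hy.1)
  · exact fun x hx y hy _ => (abs_coord_le_norm b 1 _).trans (hD x hx.1 y hy.1)
  · intro x hx y hy h0 h1
    simpa [h0, h1] using abs_normal_coord_le b hδ hδ' hx hy

theorem coord_le_of_mem_shiftFar (b : OrthonormalBasis (Fin 3) ℝ (EuclideanSpace ℝ (Fin 3)))
    {Ω : Set (EuclideanSpace ℝ (Fin 3))} (hconv : Convex ℝ Ω) {δ η h s : ℝ} (hδ : 0 ≤ δ)
    (hδ' : δ ≤ 1 / 2) (hη : 0 ≤ η) (hh : 0 < h) (hηh : 2 * η ≤ δ * h) (hs : |s| = 1)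
    {x y : EuclideanSpace ℝ (Fin 3)}
    (hx : x ∈ shiftFar Ω (b 2) δ η ((h * s) • b 1) (3 * δ * h))
    (hy : y ∈ almostSupported Ω (b 2) δ η) (h0 : inner ℝ (b 0) (y - x) = 0) :
    s * inner ℝ (b 1) (y - x) ≤ h := by
  by_contra! hlt
  have hss : s * s = 1 := by rw [← abs_mul_abs_self, hs, one_mul]
  have hd : |inner ℝ (b 1) (y - x)| = s * inner ℝ (b 1) (y - x) := by
    rw [← abs_of_pos (hh.trans hlt), abs_mul, hs, one_mul]
  set d := s * inner ℝ (b 1) (y - x) with hd_def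
  have hdpos : 0 < d := hh.trans hlt
  have hsd : inner ℝ (b 1) (y - x) = s * d := by rw [hd_def, ← mul_assoc, hss, one_mul]
  have hle := abs_normal_coord_le b hδ hδ' hy hx.1
  rw [h0, hd, abs_zero, zero_add] at hle
  have ht : h / d ≤ 1 := (div_le_one hdpos).2 hlt.le
  have ht0 : 0 < h / d := div_pos hh hdpos
  have hz : x + (h / d) • (y - x) ∈ Ω :=
    hconv.add_smul_sub_mem hx.1.1 hy.1 ⟨ht0.le, ht⟩
  have hxy : y - x = (s * d) • b 1 + inner ℝ (b 2) (y - x) • b 2 := by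
    conv_lhs => rw [← b.sum_repr' (y - x), Fin.sum_univ_three, h0, hsd, zero_smul, zero_add]
  have hdist : dist (x + (h * s) • b 1) (x + (h / d) • (y - x)) ≤ 3 * δ * h := by
    rw [dist_add_left, dist_eq_norm]
    have : (h * s) • b 1 - (h / d) • (y - x) = -((h / d) * inner ℝ (b 2) (y - x)) • b 2 := by
      conv_lhs => rw [hxy]
      rw [smul_add, smul_smul, smul_smul]
      have : h / d * (s * d) = h * s := by field_simp
      rw [this]
      module
    rw [this, norm_smul, b.norm_eq_one, mul_one, norm_neg, Real.norm_eq_abs, abs_mul,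
      abs_of_pos ht0]
    calc h / d * |inner ℝ (b 2) (y - x)| ≤ h / d * (2 * η + 2 * δ * d) := by gcongr
      _ = h / d * (2 * η) + 2 * δ * h := by field_simp
      _ ≤ 1 * (2 * η) + 2 * δ * h := by gcongr
      _ ≤ 3 * δ * h := by linarith
  exact absurd (hx.2.trans_le ((infDist_le_dist_of_mem hz).trans hdist)) (lt_irrefl _)

theorem volume_shiftFar_le (b : OrthonormalBasis (Fin 3) ℝ (EuclideanSpace ℝ (Fin 3)))
    {Ω : Set (EuclideanSpace ℝ (Fin 3))} (hΩ : IsClosed Ω) (hconv : Convex ℝ Ω) {D δ η h s : ℝ}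
    (hδ : 0 ≤ δ) (hδ' : δ ≤ 1 / 2) (hD : ∀ x ∈ Ω, ∀ y ∈ Ω, ‖x - y‖ ≤ D)
    (hη : 0 ≤ η) (hh : 0 < h) (hηh : 2 * η ≤ δ * h) (hs : |s| = 1) :
    volume (shiftFar Ω (b 2) δ η ((h * s) • b 1) (3 * δ * h)) ≤
      ENNReal.ofReal D * (ENNReal.ofReal h * ENNReal.ofReal (2 * η)) := by
  refine volume_le_of_coord_dist_le b (measurableSet_shiftFar hΩ _ _ _ _ _) ?_ ?_ ?_
  · exact fun x hx y hy => (abs_coord_le_norm b 0 _).trans (hD x hx.1.1 y hy.1.1)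
  · intro x hx y hy h0
    have h0' : inner ℝ (b 0) (y - x) = 0 := by rw [← neg_sub, inner_neg_right, h0, neg_zero]
    have h₁ := coord_le_of_mem_shiftFar b hconv hδ hδ' hη hh hηh hs hx hy.1 h0'
    have h₂ := coord_le_of_mem_shiftFar b hconv hδ hδ' hη hh hηh hs hy hx.1 h0
    rw [← neg_sub x y, inner_neg_right] at h₁
    rw [← one_mul |_|, ← hs, ← abs_mul]
    exact abs_le.2 ⟨by linarith, h₂⟩
  · intro x hx y hy h0 h1
    simpa [h0, h1] using abs_normal_coord_le b hδ hδ' hx.1 hy.1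

theorem volume_shiftFar_le' (b : OrthonormalBasis (Fin 3) ℝ (EuclideanSpace ℝ (Fin 3)))
    {Ω : Set (EuclideanSpace ℝ (Fin 3))} (hΩ : IsClosed Ω) (hconv : Convex ℝ Ω) {D δ η h s : ℝ}
    (hδ : 0 ≤ δ) (hδ' : δ ≤ 1 / 2) (hD : ∀ x ∈ Ω, ∀ y ∈ Ω, ‖x - y‖ ≤ D)
    (hη : 0 ≤ η) (hh : 0 < h) (hηh : 2 * η ≤ δ * h) (hs : |s| = 1) {i : Fin 3} (hi : i ≠ 2) :
    volume (shiftFar Ω (b 2) δ η ((h * s) • b i) (3 * δ * h)) ≤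
      ENNReal.ofReal D * (ENNReal.ofReal h * ENNReal.ofReal (2 * η)) := by
  have := volume_shiftFar_le (b.reindex (Equiv.swap i 1)) hΩ hconv hδ hδ' hD hη hh hηh hs
  rwa [OrthonormalBasis.reindex_apply, OrthonormalBasis.reindex_apply, Equiv.symm_swap,
    Equiv.swap_apply_right, Equiv.swap_apply_of_ne_of_ne hi.symm (by decide)] at this

theorem exists_unit_outward_normal {Ω : Set (EuclideanSpace ℝ (Fin 3))} (hconv : Convex ℝ Ω)
    (hint : (interior Ω).Nonempty) {p : EuclideanSpace ℝ (Fin 3)} (hp : p ∉ interior Ω) :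
    ∃ μ : EuclideanSpace ℝ (Fin 3), ‖μ‖ = 1 ∧ ∀ z ∈ Ω, inner ℝ μ z ≤ inner ℝ μ p := by
  obtain ⟨f, hf, hle⟩ := geometric_hahn_banach_of_nonempty_interior_point hconv hp hint
  set w := (InnerProductSpace.toDual ℝ (EuclideanSpace ℝ (Fin 3))).symm f with hw
  have hfw : ∀ z, f z = inner ℝ w z := fun z => by
    rw [hw, InnerProductSpace.toDual_symm_apply]
  have hw0 : w ≠ 0 := by simpa [hw] using hf
  refine ⟨‖w‖⁻¹ • w, norm_smul_inv_norm hw0, fun z hz => ?_⟩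
  rw [real_inner_smul_left, real_inner_smul_left, ← hfw, ← hfw]
  exact mul_le_mul_of_nonneg_left (hle z hz) (by positivity)

theorem exists_finite_cover_almostSupported {Ω : Set (EuclideanSpace ℝ (Fin 3))}
    (hconv : Convex ℝ Ω) (hcomp : IsCompact Ω) (hint : (interior Ω).Nonempty)
    {δ : ℝ} (hδ : 0 < δ) :
    ∃ t : Finset (EuclideanSpace ℝ (Fin 3)), (∀ e ∈ t, ‖e‖ = 1) ∧
      ∀ η, {x ∈ Ω | infDist x (frontier Ω) ≤ η} ⊆ ⋃ e ∈ t, almostSupported Ω e δ η := by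
  obtain ⟨t, hts, htf, hcov⟩ :=
    (isCompact_sphere (0 : EuclideanSpace ℝ (Fin 3)) 1).finite_cover_balls hδ
  refine ⟨htf.toFinset, fun e he => by simpa using hts (htf.mem_toFinset.1 he), ?_⟩
  rintro η x ⟨hx, hxη⟩
  have hne : (frontier Ω).Nonempty := by
    refine nonempty_frontier_iff.2 ⟨⟨x, hx⟩, fun h => ?_⟩
    exact noncompact_univ (EuclideanSpace ℝ (Fin 3)) (h ▸ hcomp)
  obtain ⟨p, hp, hpx⟩ := isClosed_frontier.exists_infDist_eq_dist hne x
  obtain ⟨ν, hν, hsup⟩ := exists_unit_outward_normal hconv hint hp.2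
  obtain ⟨e, he, hνe⟩ := Set.mem_iUnion₂.1 (hcov (show ν ∈ sphere 0 1 by simpa using hν))
  refine Set.mem_iUnion₂.2 ⟨e, htf.mem_toFinset.2 he, hx, fun z hz => ?_⟩
  have h₁ : inner ℝ ν (z - x) ≤ η := by
    have h₂ := real_inner_le_norm ν (p - x)
    rw [hν, one_mul, ← dist_eq_norm, dist_comm, ← hpx] at h₂
    have h₃ := hsup z hz
    rw [inner_sub_right] at h₂ ⊢
    linarith
  have h₄ : inner ℝ (e - ν) (z - x) ≤ δ * ‖z - x‖ := by
    refine (real_inner_le_norm _ _).trans ?_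
    gcongr
    rw [← dist_eq_norm, dist_comm]
    exact (mem_ball.1 hνe).le
  rw [inner_sub_left] at h₄
  linarith

theorem exists_orthonormalBasis_apply_two_eq {e : EuclideanSpace ℝ (Fin 3)} (he : ‖e‖ = 1) :
    ∃ b : OrthonormalBasis (Fin 3) ℝ (EuclideanSpace ℝ (Fin 3)), b 2 = e := by
  obtain ⟨b, hb⟩ := Orthonormal.exists_orthonormalBasis_extension_of_card_eq (𝕜 := ℝ)
    (E := EuclideanSpace ℝ (Fin 3)) (ι := Fin 3) (by simp) (v := fun _ => e) (s := {2})
    ⟨fun _ => he, fun i j hij => (hij (Subsingleton.elim i j)).elim⟩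
  exact ⟨b, hb 2 rfl⟩

theorem abs_coord_normal_le_of_notMem_shiftFar
    (b : OrthonormalBasis (Fin 3) ℝ (EuclideanSpace ℝ (Fin 3)))
    {Ω : Set (EuclideanSpace ℝ (Fin 3))} (hcomp : IsCompact Ω) {δ η r : ℝ} (hδ : 0 < δ)
    (hr : 0 < r) {x : EuclideanSpace ℝ (Fin 3)} (hx : x ∈ almostSupported Ω (b 2) δ η)
    {i : Fin 3} (hfar : ∀ s : ℝ, |s| = 1 →
      x ∉ shiftFar Ω (b 2) δ η ((r / δ * s) • b i) (3 * δ * (r / δ)))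
    {v μ : EuclideanSpace ℝ (Fin 3)} (hv : ‖v‖ ≤ r) (hμ : ‖μ‖ = 1)
    (hsep : ∀ z ∈ Ω, inner ℝ μ z ≤ inner ℝ μ (x + v)) : |inner ℝ (b i) μ| ≤ 4 * δ := by
  have hμv : inner ℝ μ v ≤ r := by
    have := real_inner_le_norm μ v
    rw [hμ, one_mul] at this
    linarith
  have key : ∀ s : ℝ, |s| = 1 → s * inner ℝ (b i) μ ≤ 4 * δ := by
    intro s hs
    have hnear : infDist (x + (r / δ * s) • b i) Ω ≤ 3 * δ * (r / δ) := by
      by_contra! hlt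
      exact hfar s hs ⟨hx, hlt⟩
    obtain ⟨z, hz, hdz⟩ := hcomp.exists_infDist_eq_dist ⟨x, hx.1⟩ (x + (r / δ * s) • b i)
    have h3 : 3 * δ * (r / δ) = 3 * r := by field_simp
    rw [hdz, dist_eq_norm, h3] at hnear
    have h₁ := hsep z hz
    have h₂ := real_inner_le_norm μ (x + (r / δ * s) • b i - z)
    rw [hμ, one_mul, inner_sub_right, inner_add_right, inner_smul_right,
      real_inner_comm (b i) μ] at h₂
    rw [inner_add_right] at h₁
    have h₄ : r / δ * (s * inner ℝ (b i) μ) ≤ r / δ * (4 * δ) := by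
      have : r / δ * (4 * δ) = 4 * r := by field_simp
      rw [this]
      linarith
    exact le_of_mul_le_mul_left h₄ (by positivity)
  exact abs_le'.2 ⟨by simpa using key 1 (by simp), by simpa using key (-1) (by simp)⟩

theorem half_le_or_abs_one_add_le {δ m₀ m₁ m₂ : ℝ} (hδ : 0 < δ) (hδ' : δ ≤ 1 / 400)
    (h₀ : |m₀| ≤ 4 * δ) (h₁ : |m₁| ≤ 4 * δ) (hsq : m₀ ^ 2 + m₁ ^ 2 + m₂ ^ 2 = 1) :
    1 / 2 ≤ m₂ ∨ |1 + m₂| ≤ 4 * δ := by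
  have hm₀ : m₀ ^ 2 ≤ (4 * δ) ^ 2 := sq_le_sq' (abs_le.1 h₀).1 (abs_le.1 h₀).2
  have hm₁ : m₁ ^ 2 ≤ (4 * δ) ^ 2 := sq_le_sq' (abs_le.1 h₁).1 (abs_le.1 h₁).2
  have hδ2 : δ ^ 2 ≤ δ / 400 := by nlinarith
  rcases le_or_gt 0 m₂ with hm | hm
  · left
    nlinarith
  · right
    have : -1 ≤ m₂ := by nlinarith [sq_nonneg m₀, sq_nonneg m₁]
    rw [abs_of_nonneg (by linarith)]
    nlinarith

theorem add_mem_of_notMem_shiftFar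
    (b : OrthonormalBasis (Fin 3) ℝ (EuclideanSpace ℝ (Fin 3)))
    {Ω : Set (EuclideanSpace ℝ (Fin 3))} (hconv : Convex ℝ Ω) (hcomp : IsCompact Ω)
    {D δ η r ρ : ℝ} (hδ : 0 < δ) (hD : ∀ x ∈ Ω, ∀ y ∈ Ω, ‖x - y‖ ≤ D)
    {c : EuclideanSpace ℝ (Fin 3)} (hc : closedBall c ρ ⊆ Ω) (hρ : 0 < ρ)
    (hδ' : δ ≤ 1 / 400) (hδρ : 13 * δ * D ≤ ρ / 3) (hr : 0 < r) (hrρ : r ≤ ρ / 4)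
    (hηρ : η ≤ ρ / 4) {x : EuclideanSpace ℝ (Fin 3)} (hx : x ∈ almostSupported Ω (b 2) δ η)
    (hfar : ∀ i : Fin 3, i ≠ 2 → ∀ s : ℝ, |s| = 1 →
      x ∉ shiftFar Ω (b 2) δ η ((r / δ * s) • b i) (3 * δ * (r / δ)))
    {v : EuclideanSpace ℝ (Fin 3)} (hv : ‖v‖ ≤ r) (hv2 : inner ℝ (b 2) v ≤ -r / 20) :
    x + v ∈ Ω := by
  by_contra hxv
  have hcΩ : c ∈ Ω := hc (mem_closedBall_self hρ.le)
  have hint : (interior Ω).Nonempty :=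
    ⟨c, interior_mono hc (ball_subset_interior_closedBall (mem_ball_self hρ))⟩
  obtain ⟨μ, hμ, hsep⟩ := exists_unit_outward_normal hconv hint
    (fun h => hxv (interior_subset h) : x + v ∉ interior Ω)
  have hsmall : ∀ i : Fin 3, i ≠ 2 → |inner ℝ (b i) μ| ≤ 4 * δ := fun i hi =>
    abs_coord_normal_le_of_notMem_shiftFar b hcomp hδ hr hx (hfar i hi) hv hμ hsep
  have hμ0 := hsmall 0 (by decide)
  have hμ1 := hsmall 1 (by decide)
  have hsq : inner ℝ (b 0) μ ^ 2 + inner ℝ (b 1) μ ^ 2 + inner ℝ (b 2) μ ^ 2 = 1 := by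
    have := inner_eq_coord_sum b μ μ
    rw [real_inner_self_eq_norm_sq, hμ] at this
    linarith
  rcases half_le_or_abs_one_add_le hδ hδ' hμ0 hμ1 hsq with hpos | hneg
  · have hstep : ∀ i : Fin 3, i ≠ 2 → inner ℝ (b i) μ * inner ℝ (b i) v ≤ 1 / 100 * r := by
      intro i hi
      refine (le_abs_self _).trans ?_
      rw [abs_mul]
      have h4δ : 4 * δ ≤ 1 / 100 := by linarith only [hδ']
      exact mul_le_mul ((hsmall i hi).trans h4δ) ((abs_coord_le_norm b i v).trans hv)
        (abs_nonneg _) (by norm_num)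
    have h₁ := hstep 0 (by decide)
    have h₂ := hstep 1 (by decide)
    have h₃ := hsep x hx.1
    rw [inner_add_right, inner_eq_coord_sum b μ v] at h₃
    nlinarith only [h₁, h₂, h₃, hpos, hv2, hr]
  · have hμe : ‖μ + b 2‖ ≤ 12 * δ := by
      have h := norm_le_sum_abs_coord b (μ + b 2)
      have h0 : inner ℝ (b 0) (b 2) = 0 := b.inner_eq_zero (by decide)
      have h1 : inner ℝ (b 1) (b 2) = 0 := b.inner_eq_zero (by decide)
      have h2 : inner ℝ (b 2) (b 2) = 1 := b.inner_eq_one 2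
      rw [inner_add_right, inner_add_right, inner_add_right, h0, h1, h2, add_zero, add_zero,
        add_comm _ (1 : ℝ)] at h
      linarith only [h, hμ0, hμ1, hneg]
    have hball : c + ρ • μ ∈ Ω := hc (by simp [norm_smul, hμ, abs_of_pos hρ])
    have h₂ := hsep _ hball
    rw [inner_add_right, inner_add_right, inner_smul_right, real_inner_self_eq_norm_sq, hμ] at h₂
    have h₃ := hx.2 c hcΩ
    have hcx := hD c hcΩ x hx.1
    have hμv := real_inner_le_norm μ v
    rw [hμ, one_mul] at hμv
    have h₄ := (abs_le.1 (abs_real_inner_le_norm (μ + b 2) (c - x))).1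
    have h₅ := mul_le_mul hμe hcx (norm_nonneg _) (by positivity)
    rw [inner_add_left, inner_sub_right μ] at h₄
    have h₆ := mul_le_mul_of_nonneg_left hcx hδ.le
    linarith only [h₂, h₃, hμv, h₄, h₅, h₆, hv, hδρ, hrρ, hηρ, hρ]

theorem ofReal_le_volume_of_notMem_shiftFar
    (b : OrthonormalBasis (Fin 3) ℝ (EuclideanSpace ℝ (Fin 3)))
    {Ω : Set (EuclideanSpace ℝ (Fin 3))} {r : ℝ} (hr : 0 < r) {x : EuclideanSpace ℝ (Fin 3)}
    (hx : ∀ v : EuclideanSpace ℝ (Fin 3), ‖v‖ ≤ r → inner ℝ (b 2) v ≤ -r / 20 → x + v ∈ Ω) :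
    ENNReal.ofReal ((9 / 20) ^ 3 * (π * 4 / 3) * r ^ 3) ≤ volume (closedBall x r ∩ Ω) := by
  have hsub : closedBall (x - (r / 2) • b 2) (9 / 20 * r) ⊆ closedBall x r ∩ Ω := by
    intro y hy
    rw [mem_closedBall, dist_eq_norm] at hy
    have hw : y - (x - (r / 2) • b 2) = (y - x) + (r / 2) • b 2 := by abel
    rw [hw] at hy
    have hn : ‖y - x‖ ≤ r := by
      have := norm_sub_le (y - x + (r / 2) • b 2) ((r / 2) • b 2)
      rw [add_sub_cancel_right, norm_smul, b.norm_eq_one, Real.norm_eq_abs,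
        abs_of_pos (half_pos hr)] at this
      linarith
    refine ⟨by rwa [mem_closedBall, dist_eq_norm], ?_⟩
    have := hx (y - x) hn ?_
    · rwa [add_sub_cancel] at this
    · have := (le_abs_self _).trans ((abs_coord_le_norm b 2 _).trans hy)
      have h2 : inner ℝ (b 2) (b 2) = 1 := b.inner_eq_one 2
      rw [inner_add_right, inner_smul_right, h2] at this
      linarith
  refine le_trans (le_of_eq ?_) (measure_mono hsub)
  rw [EuclideanSpace.volume_closedBall_fin_three, ← ENNReal.ofReal_pow (by positivity),
    ← ENNReal.ofReal_mul (by positivity)]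
  congr 1
  ring

theorem exists_volume_closedBall_inter_ge {Ω : Set (EuclideanSpace ℝ (Fin 3))}
    (hconv : Convex ℝ Ω) {D ρ : ℝ} (hD : ∀ x ∈ Ω, ∀ y ∈ Ω, ‖x - y‖ ≤ D)
    {c : EuclideanSpace ℝ (Fin 3)} (hc : closedBall c ρ ⊆ Ω) (hρ : 0 < ρ) (hDpos : 0 < D)
    {r : ℝ} (hr : 0 < r) (hrD : r ≤ D) {x : EuclideanSpace ℝ (Fin 3)} (hx : x ∈ Ω) :
    ENNReal.ofReal ((ρ / D) ^ 3 * (π * 4 / 3) * r ^ 3) ≤ volume (closedBall x r ∩ Ω) := by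
  have ht : 0 < r / D := by positivity
  have hsub : closedBall (x + (r / D) • (c - x)) (r / D * ρ) ⊆ closedBall x r ∩ Ω := by
    intro y hy
    set w := c + (r / D)⁻¹ • (y - (x + (r / D) • (c - x))) with hw
    have hwΩ : w ∈ Ω := by
      apply hc
      rw [mem_closedBall, dist_eq_norm] at hy ⊢
      rw [hw, add_sub_cancel_left, norm_smul, norm_inv, Real.norm_eq_abs, abs_of_pos ht]
      rwa [inv_mul_le_iff₀ ht]
    have hyw : y = x + (r / D) • (w - x) := by
      rw [hw, smul_sub, smul_add, smul_smul, mul_inv_cancel₀ ht.ne', one_smul]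
      module
    refine ⟨?_, ?_⟩
    · rw [mem_closedBall, dist_eq_norm, hyw, add_sub_cancel_left, norm_smul, Real.norm_eq_abs,
        abs_of_pos ht]
      calc r / D * ‖w - x‖ ≤ r / D * D := by gcongr; exact hD _ hwΩ _ hx
        _ = r := by field_simp
    · rw [hyw]
      exact hconv.add_smul_sub_mem hx hwΩ ⟨ht.le, (div_le_one hDpos).2 hrD⟩
  refine le_trans (le_of_eq ?_) (measure_mono hsub)
  rw [EuclideanSpace.volume_closedBall_fin_three, ← ENNReal.ofReal_pow (by positivity),
    ← ENNReal.ofReal_mul (by positivity)]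
  congr 1
  field_simp

theorem exists_boundary_strip_estimates {Ω : Set (EuclideanSpace ℝ (Fin 3))}
    (hconv : Convex ℝ Ω) (hcomp : IsCompact Ω) (hint : (interior Ω).Nonempty)
    {C : ℝ} (hC : 0 < C) :
    ∃ M > 0, ∃ c₀ > 0, ∃ r₀ > 0, ∀ r : ℝ, 0 < r → r < r₀ →
      ∃ Bad : Set (EuclideanSpace ℝ (Fin 3)),
        volume {x ∈ Ω | infDist x (frontier Ω) ≤ C * r ^ 2} ≤ ENNReal.ofReal (M * r ^ 2) ∧
        volume Bad ≤ ENNReal.ofReal (M * r ^ 3) ∧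
        (∀ x ∈ {x ∈ Ω | infDist x (frontier Ω) ≤ C * r ^ 2} \ Bad,
          ENNReal.ofReal ((9 / 20) ^ 3 * (π * 4 / 3) * r ^ 3) ≤ volume (closedBall x r ∩ Ω)) ∧
        ∀ x ∈ Ω, ENNReal.ofReal (c₀ * r ^ 3) ≤ volume (closedBall x r ∩ Ω) := by
  obtain ⟨c, hcint⟩ := hint
  obtain ⟨ρ, hρ, hc⟩ := nhds_basis_closedBall.mem_iff.1 (mem_interior_iff_mem_nhds.1 hcint)
  obtain ⟨D, hDpos, hD⟩ : ∃ D > 0, ∀ x ∈ Ω, ∀ y ∈ Ω, ‖x - y‖ ≤ D := by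
    refine ⟨diam Ω + 1, by positivity, fun x hx y hy => ?_⟩
    rw [← dist_eq_norm]
    linarith [dist_le_diam_of_mem hcomp.isBounded hx hy]
  obtain ⟨δ, hδ, hδ', hδρ⟩ : ∃ δ > 0, δ ≤ 1 / 400 ∧ 13 * δ * D ≤ ρ / 3 := by
    refine ⟨min (1 / 400) (ρ / (39 * D)), by positivity, min_le_left _ _, ?_⟩
    calc 13 * min (1 / 400) (ρ / (39 * D)) * D ≤ 13 * (ρ / (39 * D)) * D := by
          gcongr
          exact min_le_right _ _
      _ = ρ / 3 := by
          field_simp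
          norm_num
  obtain ⟨t, ht, hcov⟩ := exists_finite_cover_almostSupported hconv hcomp ⟨c, hcint⟩ hδ
  have : Nonempty (OrthonormalBasis (Fin 3) ℝ (EuclideanSpace ℝ (Fin 3))) :=
    ⟨EuclideanSpace.basisFun _ _⟩
  choose! b hb using fun e (he : ‖e‖ = 1) => exists_orthonormalBasis_apply_two_eq he
  let Q : Finset (Fin 3 × ℝ) := {0, 1} ×ˢ {1, -1}
  have hQ : ∀ q ∈ Q, q.1 ≠ 2 ∧ |q.2| = 1 := by
    rintro ⟨i, s⟩ hq
    simp only [Q, Finset.mem_product, Finset.mem_insert, Finset.mem_singleton] at hq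
    rcases hq with ⟨rfl | rfl, rfl | rfl⟩ <;> simp
  have hQ' : ∀ i : Fin 3, i ≠ 2 → ∀ s : ℝ, |s| = 1 → (i, s) ∈ Q := by
    intro i hi s hs
    simp only [Q, Finset.mem_product, Finset.mem_insert, Finset.mem_singleton]
    refine ⟨?_, (abs_eq zero_le_one).1 hs⟩
    fin_cases i <;> simp_all
  refine ⟨t.card * (D * (D * (2 * C))) + t.card * (Q.card * (D * (1 / δ * (2 * C)))) + 1,
    by positivity, (ρ / D) ^ 3 * (π * 4 / 3), by positivity,
    min (min (1 / (2 * C)) D) (ρ / 4 * min 1 (1 / C)), by positivity, fun r hr hr₀ => ?_⟩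
  obtain ⟨h₁₂, h₃⟩ := lt_min_iff.1 hr₀
  obtain ⟨h₁, h₂⟩ := lt_min_iff.1 h₁₂
  have hrC : r * (2 * C) < 1 := (lt_div_iff₀ (by positivity)).1 h₁
  have hrρ : r ≤ ρ / 4 := by
    refine h₃.le.trans (mul_le_of_le_one_right (by positivity) (min_le_left _ _))
  have hηρ : C * r ^ 2 ≤ ρ / 4 := by nlinarith
  have hη : 0 ≤ C * r ^ 2 := by positivity
  have hηh : 2 * (C * r ^ 2) ≤ δ * (r / δ) := by
    rw [mul_div_cancel₀ _ hδ.ne']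
    nlinarith
  refine ⟨⋃ e ∈ t, ⋃ q ∈ Q, shiftFar Ω (b e 2) δ (C * r ^ 2) ((r / δ * q.2) • b e q.1)
    (3 * δ * (r / δ)), ?_, ?_, ?_, ?_⟩
  · calc volume {x ∈ Ω | infDist x (frontier Ω) ≤ C * r ^ 2}
        ≤ volume (⋃ e ∈ t, almostSupported Ω e δ (C * r ^ 2)) := measure_mono (hcov _)
      _ ≤ ∑ e ∈ t, volume (almostSupported Ω e δ (C * r ^ 2)) := measure_biUnion_finset_le _ _
      _ ≤ t.card • ENNReal.ofReal (D * (D * (2 * (C * r ^ 2)))) := by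
          refine Finset.sum_le_card_nsmul _ _ _ fun e he => ?_
          have := volume_almostSupported_le (b e) hcomp.isClosed (η := C * r ^ 2) hδ.le
            (by linarith) hD
          rw [hb e (ht e he)] at this
          rwa [ENNReal.ofReal_mul hDpos.le, ENNReal.ofReal_mul hDpos.le]
      _ ≤ _ := by
          rw [← ENNReal.ofReal_nsmul]
          refine ENNReal.ofReal_le_ofReal ?_
          rw [nsmul_eq_mul, add_mul, add_mul]
          have : (0 : ℝ) ≤ t.card * (Q.card * (D * (1 / δ * (2 * C)))) * r ^ 2 := by positivity
          have : (0 : ℝ) ≤ r ^ 2 := by positivity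
          linarith
  · calc _ ≤ ∑ e ∈ t, volume (⋃ q ∈ Q, shiftFar Ω (b e 2) δ (C * r ^ 2)
            ((r / δ * q.2) • b e q.1) (3 * δ * (r / δ))) := measure_biUnion_finset_le _ _
      _ ≤ t.card • Q.card • ENNReal.ofReal (D * (r / δ * (2 * (C * r ^ 2)))) := by
          refine Finset.sum_le_card_nsmul _ _ _ fun e he => ?_
          refine (measure_biUnion_finset_le _ _).trans ?_
          refine Finset.sum_le_card_nsmul _ _ _ fun q hq => ?_
          rw [ENNReal.ofReal_mul hDpos.le, ENNReal.ofReal_mul (by positivity)]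
          exact volume_shiftFar_le' (b e) hcomp.isClosed hconv hδ.le (by linarith) hD hη
            (by positivity) hηh (hQ q hq).2 (hQ q hq).1
      _ ≤ _ := by
          rw [← ENNReal.ofReal_nsmul, ← ENNReal.ofReal_nsmul]
          refine ENNReal.ofReal_le_ofReal ?_
          rw [nsmul_eq_mul, nsmul_eq_mul, add_mul, add_mul]
          have : (0 : ℝ) ≤ t.card * (D * (D * (2 * C))) * r ^ 3 := by positivity
          have : (0 : ℝ) ≤ r ^ 3 := by positivity
          have : (t.card : ℝ) * (Q.card * (D * (r / δ * (2 * (C * r ^ 2))))) =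
              t.card * (Q.card * (D * (1 / δ * (2 * C)))) * r ^ 3 := by ring
          linarith
  · rintro x ⟨hx, hbad⟩
    obtain ⟨e, he, hxe⟩ := Set.mem_iUnion₂.1 (hcov _ hx)
    rw [← hb e (ht e he)] at hxe
    refine ofReal_le_volume_of_notMem_shiftFar (b e) hr fun v hv hv2 =>
      add_mem_of_notMem_shiftFar (b e) hconv hcomp hδ hD hc hρ hδ' hδρ hr hrρ hηρ hxe
        (fun i hi s hs hmem => hbad ?_) hv hv2
    exact Set.mem_iUnion₂.2 ⟨e, he, Set.mem_iUnion₂.2 ⟨(i, s), hQ' i hi s hs, hmem⟩⟩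
  · exact fun x hx => exists_volume_closedBall_inter_ge hconv hD hc hρ hDpos hr h₂.le hx

theorem setIntegral_le_of_lower_bounds {Ω A Bad : Set (EuclideanSpace ℝ (Fin 3))} (hAΩ : A ⊆ Ω)
    {r v₁ v₂ m₁ m₂ N : ℝ} (hr : 0 < r) (hN : 0 ≤ N) (hm₁ : 0 ≤ m₁) (hm₂ : 0 ≤ m₂) (k : ℕ)
    (hA : volume A ≤ ENNReal.ofReal m₁) (hBad : volume Bad ≤ ENNReal.ofReal m₂)
    (h₁ : ∀ x ∈ A \ Bad, ENNReal.ofReal v₁ ≤ volume (closedBall x r ∩ Ω))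
    (h₂ : ∀ x ∈ Ω, ENNReal.ofReal v₂ ≤ volume (closedBall x r ∩ Ω)) :
    |∫ x in A, (N * (volume (closedBall x r ∩ Ω)).toReal) ^ k *
        Real.exp (-(N * (volume (closedBall x r ∩ Ω)).toReal)) / (k.factorial : ℝ)| ≤
      (N * (r ^ 3 * (π * 4 / 3))) ^ k *
        (Real.exp (-(N * v₁)) * m₁ + Real.exp (-(N * v₂)) * m₂) := by
  set V : EuclideanSpace ℝ (Fin 3) → ℝ := fun x => (volume (closedBall x r ∩ Ω)).toReal
  set P := (N * (r ^ 3 * (π * 4 / 3))) ^ k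
  have hP0 : 0 ≤ P := by positivity
  have hfin : ∀ x, volume (closedBall x r ∩ Ω) ≠ ⊤ := fun x =>
    ((measure_mono Set.inter_subset_left).trans_lt measure_closedBall_lt_top).ne
  have hVle : ∀ x, V x ≤ r ^ 3 * (π * 4 / 3) := by
    intro x
    refine ENNReal.toReal_le_of_le_ofReal (by positivity)
      ((measure_mono Set.inter_subset_left).trans_eq ?_)
    rw [EuclideanSpace.volume_closedBall_fin_three, ← ENNReal.ofReal_pow hr.le,
      ← ENNReal.ofReal_mul (by positivity)]
  have hV0 : ∀ x, 0 ≤ V x := fun x => ENNReal.toReal_nonneg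
  have hbound : ∀ x (v : ℝ), ENNReal.ofReal v ≤ volume (closedBall x r ∩ Ω) →
      ENNReal.ofReal ‖(N * V x) ^ k * Real.exp (-(N * V x)) / (k.factorial : ℝ)‖ ≤
        ENNReal.ofReal (P * Real.exp (-(N * v))) := by
    intro x v hv
    have hv' : v ≤ V x := (ENNReal.ofReal_le_iff_le_toReal (hfin x)).1 hv
    have hNV : 0 ≤ N * V x := mul_nonneg hN (hV0 x)
    refine ENNReal.ofReal_le_ofReal ?_
    rw [Real.norm_of_nonneg (by positivity)]
    refine (div_le_self (by positivity) (mod_cast k.factorial_pos)).trans ?_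
    have hpow : (N * V x) ^ k ≤ P :=
      pow_le_pow_left₀ hNV (mul_le_mul_of_nonneg_left (hVle x) hN) k
    gcongr
  rw [← Real.norm_eq_abs]
  refine (norm_integral_le_lintegral_norm _).trans
    (ENNReal.toReal_le_of_le_ofReal (by positivity) ?_)
  calc _ ≤ ∫⁻ x in (A \ Bad) ∪ (A ∩ Bad),
          ENNReal.ofReal ‖(N * V x) ^ k * Real.exp (-(N * V x)) / (k.factorial : ℝ)‖ := by
        rw [Set.sdiff_union_inter]
    _ ≤ _ := lintegral_union_le _ _ _
    _ ≤ ENNReal.ofReal (P * Real.exp (-(N * v₁))) * ENNReal.ofReal m₁ +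
          ENNReal.ofReal (P * Real.exp (-(N * v₂))) * ENNReal.ofReal m₂ := by
        gcongr
        · refine (setLIntegral_mono measurable_const fun x hx => hbound x v₁ (h₁ x hx)).trans ?_
          rw [setLIntegral_const]
          gcongr
          exact (measure_mono Set.sdiff_subset).trans hA
        · refine (setLIntegral_mono measurable_const fun x hx =>
            hbound x v₂ (h₂ x (hAΩ hx.1))).trans ?_
          rw [setLIntegral_const]
          gcongr
          exact (measure_mono Set.inter_subset_right).trans hBad
    _ = _ := by
        rw [← ENNReal.ofReal_mul (by positivity), ← ENNReal.ofReal_mul (by positivity),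
          ← ENNReal.ofReal_add (by positivity) (by positivity)]
        congr 1
        ring

theorem eventually_log_perturbation_bounds (a ξ : ℝ) :
    ∀ᶠ n : ℕ in atTop, 1 ≤ Real.log n ∧
      99 / 100 * Real.log n ≤ Real.log n + a * Real.log (Real.log n) + ξ ∧
      Real.log n + a * Real.log (Real.log n) + ξ ≤ 2 * Real.log n := by
  have hlog : Tendsto (fun n : ℕ => Real.log n) atTop atTop :=
    Real.tendsto_log_atTop.comp tendsto_natCast_atTop_atTop
  have ho : (fun y : ℝ => a * Real.log y + ξ) =o[atTop] (id : ℝ → ℝ) :=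
    (Real.isLittleO_log_id_atTop.const_mul_left a).add
      (Asymptotics.isLittleO_const_id_atTop ξ)
  have h := (ho.bound (show (0 : ℝ) < 1 / 100 by norm_num)).and (eventually_ge_atTop 1)
  filter_upwards [hlog.eventually h] with n hn
  obtain ⟨h₁, h₂⟩ := hn
  rw [id, Real.norm_eq_abs, Real.norm_eq_abs, abs_of_nonneg (zero_le_one.trans h₂)] at h₁
  obtain ⟨h₃, h₄⟩ := abs_le.1 h₁
  exact ⟨h₂, by linarith, by linarith⟩

theorem tendsto_pow_log_mul_exp_neg_mul_log (K : ℝ) (m : ℕ) {b : ℝ} (hb : 0 < b) :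
    Tendsto (fun n : ℕ => K * (Real.log n ^ m * Real.exp (-b * Real.log n))) atTop (𝓝 0) := by
  have h := (tendsto_rpow_mul_exp_neg_mul_atTop_nhds_zero m b hb).comp
    (Real.tendsto_log_atTop.comp tendsto_natCast_atTop_atTop)
  simpa [Function.comp_def] using h.const_mul K

theorem mul_sq_le_of_mul_cube_le {n r ℓ : ℝ} (hn : 0 < n) (hℓ : Real.log n = ℓ) (hℓ1 : 1 ≤ ℓ)
    (hr : 0 ≤ r) (h : n * r ^ 3 ≤ 5 * ℓ) : n * r ^ 2 ≤ 5 * ℓ * Real.exp (ℓ / 3) := by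
  have hexp : Real.exp (ℓ / 3) ^ 3 = n := by
    rw [← Real.exp_nat_mul, Nat.cast_ofNat, mul_div_cancel₀ _ (three_ne_zero' ℝ), ← hℓ,
      Real.exp_log hn]
  refine le_of_pow_le_pow_left₀ three_ne_zero (by positivity) ?_
  calc (n * r ^ 2) ^ 3 = n * (n * r ^ 3) ^ 2 := by ring
    _ ≤ n * (5 * ℓ) ^ 2 := by gcongr
    _ ≤ n * (5 * ℓ) ^ 3 := by
        gcongr
        · linarith
        · norm_num
    _ = (5 * ℓ * Real.exp (ℓ / 3)) ^ 3 := by rw [mul_pow _ (Real.exp _), hexp, mul_comm]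

theorem mul_tail_bound_le {n r ℓ L M c₀ : ℝ} (k : ℕ) (hn : 0 < n) (hℓ : Real.log n = ℓ)
    (hℓ1 : 1 ≤ ℓ) (hL : 99 / 100 * ℓ ≤ L) (hL' : L ≤ 2 * ℓ) (hr : 0 ≤ r) (hM : 0 ≤ M)
    (hc₀ : 0 ≤ c₀) (hnr : n * r ^ 3 = 16 / (5 * π) * L) :
    n * ((n * (r ^ 3 * (π * 4 / 3))) ^ k *
      (Real.exp (-(n * ((9 / 20) ^ 3 * (π * 4 / 3) * r ^ 3))) * (M * r ^ 2) +
        Real.exp (-(n * (c₀ * r ^ 3))) * (M * r ^ 3))) ≤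
      10 ^ k * 5 * M * (ℓ ^ (k + 1) * Real.exp (-(7 / 150) * ℓ)) +
        10 ^ k * 5 * M * (ℓ ^ (k + 1) * Real.exp (-(c₀ / 2) * ℓ)) := by
  have hπ := Real.pi_pos
  have hball : n * (r ^ 3 * (π * 4 / 3)) = 64 / 15 * L := by
    calc n * (r ^ 3 * (π * 4 / 3)) = n * r ^ 3 * (π * 4 / 3) := by ring
      _ = _ := by
        rw [hnr]
        field_simp
        ring
  have hL0 : 0 ≤ L := by linarith
  have hub : 16 / (5 * π) ≤ 2 := by
    rw [div_le_iff₀ (by positivity)]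
    linarith [Real.pi_gt_three]
  have hlb : 4 / 5 ≤ 16 / (5 * π) := by
    rw [le_div_iff₀ (by positivity)]
    linarith [Real.pi_le_four]
  have hnr5 : n * r ^ 3 ≤ 5 * ℓ := by
    rw [hnr]
    nlinarith
  have hnr2 := mul_sq_le_of_mul_cube_le hn hℓ hℓ1 hr hnr5
  have hpow : (n * (r ^ 3 * (π * 4 / 3))) ^ k ≤ 10 ^ k * ℓ ^ k := by
    rw [hball, ← mul_pow]
    refine pow_le_pow_left₀ (by positivity) (by linarith) k
  have he₁ : Real.exp (-(n * ((9 / 20) ^ 3 * (π * 4 / 3) * r ^ 3))) ≤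
      Real.exp (-(19 / 50) * ℓ) := by
    refine Real.exp_le_exp.2 ?_
    have : n * ((9 / 20) ^ 3 * (π * 4 / 3) * r ^ 3) = (9 / 20) ^ 3 * (64 / 15 * L) := by
      rw [← hball]
      ring
    rw [this]
    linarith
  have he₂ : Real.exp (-(n * (c₀ * r ^ 3))) ≤ Real.exp (-(c₀ / 2) * ℓ) := by
    refine Real.exp_le_exp.2 ?_
    have h₁ : ℓ / 2 ≤ n * r ^ 3 := by
      rw [hnr]
      nlinarith
    have h₂ := mul_le_mul_of_nonneg_left h₁ hc₀
    have : n * (c₀ * r ^ 3) = c₀ * (n * r ^ 3) := by ring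
    rw [this]
    linarith
  have hsplit : Real.exp (ℓ / 3) * Real.exp (-(19 / 50) * ℓ) = Real.exp (-(7 / 150) * ℓ) := by
    rw [← Real.exp_add]
    congr 1
    ring
  calc _ = (n * (r ^ 3 * (π * 4 / 3))) ^ k *
        (Real.exp (-(n * ((9 / 20) ^ 3 * (π * 4 / 3) * r ^ 3))) * (M * (n * r ^ 2)) +
          Real.exp (-(n * (c₀ * r ^ 3))) * (M * (n * r ^ 3))) := by ring
    _ ≤ (10 ^ k * ℓ ^ k) * (Real.exp (-(19 / 50) * ℓ) * (M * (5 * ℓ * Real.exp (ℓ / 3))) +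
          Real.exp (-(c₀ / 2) * ℓ) * (M * (5 * ℓ))) := by gcongr
    _ = _ := by
        rw [← hsplit]
        ring

theorem boundary_strip_integral_vanishes
    (Ω : Set (EuclideanSpace ℝ (Fin 3)))
    (hconv : Convex ℝ Ω) (hcomp : IsCompact Ω) (hint : (interior Ω).Nonempty)
    (hvol : volume Ω = 1)
    (k : ℕ) (hk : 1 ≤ k) (ξ : ℝ) (G : ℝ) (hG : 0 < G)
    (r : ℕ → ℝ)
    (hr : ∀ n : ℕ, r n = ((16 / (5 * π)) *
        (Real.log n + ((3 * (k : ℝ)) / 2 - 1) * Real.log (Real.log n) + ξ) / n)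
        ^ ((1 : ℝ) / 3)) :
    Tendsto (fun n : ℕ =>
        (n : ℝ) * ∫ x in {x ∈ Ω | infDist x (frontier Ω) ≤ (G + 1) * r n ^ 2},
          ((n : ℝ) * (volume (closedBall x (r n) ∩ Ω)).toReal) ^ k *
            Real.exp (-((n : ℝ) * (volume (closedBall x (r n) ∩ Ω)).toReal)) /
              (k.factorial : ℝ))
      atTop (𝓝 0) := by
  obtain ⟨M, hM, c₀, hc₀, r₀, hr₀, hest⟩ :=
    exists_boundary_strip_estimates hconv hcomp hint (C := G + 1) (by linarith)
  have hlim := (tendsto_pow_log_mul_exp_neg_mul_log (10 ^ k * 5 * M) (k + 1)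
    (show (0 : ℝ) < 7 / 150 by norm_num)).add
      (tendsto_pow_log_mul_exp_neg_mul_log (10 ^ k * 5 * M) (k + 1) (half_pos hc₀))
  rw [add_zero] at hlim
  refine squeeze_zero_norm' ?_ hlim
  have hlogdiv : ∀ᶠ n : ℕ in atTop, 4 * (Real.log n / n) < r₀ ^ 3 := by
    have h := (Real.isLittleO_log_id_atTop.tendsto_div_nhds_zero.comp
      tendsto_natCast_atTop_atTop (α := ℕ)).const_mul 4
    rw [mul_zero] at h
    exact h.eventually_lt_const (by positivity)
  filter_upwards [eventually_log_perturbation_bounds (3 * (k : ℝ) / 2 - 1) ξ, hlogdiv,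
    eventually_gt_atTop 0] with n ⟨hℓ, hL, hL'⟩ hdiv hn
  have hn' : (0 : ℝ) < n := mod_cast hn
  specialize hr n
  set L := Real.log n + ((3 * (k : ℝ)) / 2 - 1) * Real.log (Real.log n) + ξ with hL_def
  have hLpos : 0 < L := by linarith
  have hpos : 0 < 16 / (5 * π) * L / n := by positivity
  have hrpos : 0 < r n := hr ▸ Real.rpow_pos_of_pos hpos _
  have hr3 : r n ^ 3 = 16 / (5 * π) * L / n := by
    rw [hr, ← Real.rpow_natCast, ← Real.rpow_mul hpos.le]
    norm_num
  have hnr : n * r n ^ 3 = 16 / (5 * π) * L := by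
    rw [hr3]
    field_simp
  have hrlt : r n < r₀ := by
    refine lt_of_pow_lt_pow_left₀ 3 hr₀.le (lt_of_le_of_lt ?_ hdiv)
    have hub : 16 / (5 * π) ≤ 2 := by
      rw [div_le_iff₀ (by positivity)]
      linarith [Real.pi_gt_three]
    rw [hr3, ← mul_div_assoc]
    refine div_le_div_of_nonneg_right ?_ hn'.le
    nlinarith
  obtain ⟨Bad, hA, hBad, hgood, hall⟩ := hest (r n) hrpos hrlt
  have hint_le := setIntegral_le_of_lower_bounds (fun x hx => hx.1) hrpos hn'.le (by positivity)
    (by positivity) k hA hBad hgood hall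
  rw [norm_mul, Real.norm_of_nonneg hn'.le, Real.norm_eq_abs]
  exact (mul_le_mul_of_nonneg_left hint_le hn'.le).trans
    (mul_tail_bound_le k hn' rfl hℓ hL hL' hrpos.le hM.le hc₀.le hnr)
end

section
/- Let x, y ∈ ℝ³ with d = ‖x − y‖ satisfying 0 < d < r. Then the Lebesgue volume of the set {z ∈ ℝ³ : ‖z − x‖ ≤ r, ⟨z − x, y − x⟩ ≥ 0, ‖z − y‖ > r} (the half of the ball B(x, r) on the side of the plane through x perpendicular to xy containing y, minus the ball B(y, r)) equals (1/4)·π·d³. -/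
open MeasureTheory Metric Real Filter Topology
open scoped RealInnerProductSpace

/-- The area of a planar annulus, in coordinates. -/
lemma volume_annulus_fin_two {a b : ℝ} (ha : 0 ≤ a) (hab : a ≤ b) :
    volume {w : Fin 2 → ℝ | a < w 0 ^ 2 + w 1 ^ 2 ∧ w 0 ^ 2 + w 1 ^ 2 ≤ b}
      = ENNReal.ofReal (π * (b - a)) := by
  have hb : 0 ≤ b := ha.trans hab
  have hball (c : ℝ) (hc : 0 ≤ c) (w : EuclideanSpace ℝ (Fin 2)) :
      w ∈ closedBall 0 (√c) ↔ w 0 ^ 2 + w 1 ^ 2 ≤ c := by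
    rw [mem_closedBall_zero_iff, Real.le_sqrt (norm_nonneg _) hc, EuclideanSpace.real_norm_sq_eq,
      Fin.sum_univ_two]
  have hvol (c : ℝ) (hc : 0 ≤ c) :
      volume (closedBall (0 : EuclideanSpace ℝ (Fin 2)) (√c)) = ENNReal.ofReal (π * c) := by
    rw [EuclideanSpace.volume_closedBall_fin_two, ← ENNReal.ofReal_pow (Real.sqrt_nonneg _),
      Real.sq_sqrt hc, ← ENNReal.ofReal_mul hc, mul_comm]
  have hmeas : MeasurableSet {w : Fin 2 → ℝ | a < w 0 ^ 2 + w 1 ^ 2 ∧ w 0 ^ 2 + w 1 ^ 2 ≤ b} := by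
    rw [Set.ofPred_and]
    exact (measurableSet_lt (by fun_prop) (by fun_prop)).inter
      (measurableSet_le (by fun_prop) (by fun_prop))
  rw [← (PiLp.volume_preserving_ofLp (Fin 2)).measure_preimage hmeas.nullMeasurableSet]
  have hset : WithLp.ofLp ⁻¹' {w : Fin 2 → ℝ | a < w 0 ^ 2 + w 1 ^ 2 ∧ w 0 ^ 2 + w 1 ^ 2 ≤ b}
      = closedBall (0 : EuclideanSpace ℝ (Fin 2)) (√b) \ closedBall 0 (√a) := by
    ext w
    rw [Set.mem_sdiff, hball b hb, hball a ha, not_le, and_comm]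
    rfl
  rw [hset, measure_sdiff (closedBall_subset_closedBall (Real.sqrt_le_sqrt hab))
    measurableSet_closedBall.nullMeasurableSet measure_closedBall_lt_top.ne, hvol b hb, hvol a ha,
    ← ENNReal.ofReal_sub _ (by positivity), mul_sub]

/-- The half-ball minus a ball, in coordinates adapted to the axis of the two centres. -/
def halfBallDiffBallCoord (r d : ℝ) : Set (ℝ × (Fin 2 → ℝ)) :=
  {p | p.1 ^ 2 + (p.2 0 ^ 2 + p.2 1 ^ 2) ≤ r ^ 2 ∧ 0 ≤ p.1 ∧
    r ^ 2 < (p.1 - d) ^ 2 + (p.2 0 ^ 2 + p.2 1 ^ 2)}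

lemma measurableSet_halfBallDiffBallCoord (r d : ℝ) :
    MeasurableSet (halfBallDiffBallCoord r d) := by
  rw [halfBallDiffBallCoord, Set.ofPred_and, Set.ofPred_and]
  exact (measurableSet_le (by fun_prop) (by fun_prop)).inter
    ((measurableSet_le (by fun_prop) (by fun_prop)).inter
      (measurableSet_lt (by fun_prop) (by fun_prop)))

lemma volume_halfBallDiffBallCoord {r d : ℝ} (hd : 0 < d) (hdr : d < r) :
    volume (halfBallDiffBallCoord r d) = ENNReal.ofReal (1 / 4 * π * d ^ 3) := by
  have hsection (t : ℝ) : volume (Prod.mk t ⁻¹' halfBallDiffBallCoord r d)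
      = (Set.Icc 0 (d / 2)).indicator (fun t => ENNReal.ofReal (π * (d ^ 2 - 2 * d * t))) t := by
    by_cases ht : t ∈ Set.Icc 0 (d / 2)
    · rw [Set.indicator_of_mem ht]
      obtain ⟨h0, h1⟩ := ht
      have hset : Prod.mk t ⁻¹' halfBallDiffBallCoord r d
          = {w : Fin 2 → ℝ | r ^ 2 - (t - d) ^ 2 < w 0 ^ 2 + w 1 ^ 2 ∧
              w 0 ^ 2 + w 1 ^ 2 ≤ r ^ 2 - t ^ 2} := by
        ext w
        simp only [halfBallDiffBallCoord, Set.mem_preimage, Set.mem_ofPred_eq]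
        constructor
        · rintro ⟨h2, -, h3⟩
          constructor <;> linarith
        · rintro ⟨h2, h3⟩
          exact ⟨by linarith, h0, by linarith⟩
      rw [hset, volume_annulus_fin_two (by nlinarith) (by nlinarith)]
      congr 1
      ring
    · rw [Set.indicator_of_notMem ht]
      convert measure_empty (μ := (volume : Measure (Fin 2 → ℝ)))
      refine Set.eq_empty_of_forall_notMem fun w hw => ht ?_
      obtain ⟨h2, h0, h3⟩ := hw
      dsimp only at h0 h2 h3
      exact ⟨h0, by nlinarith⟩
  rw [Measure.volume_eq_prod, Measure.prod_apply (measurableSet_halfBallDiffBallCoord r d),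
    lintegral_congr hsection, lintegral_indicator measurableSet_Icc,
    ← ofReal_integral_eq_lintegral_ofReal]
  · congr 1
    rw [integral_Icc_eq_integral_Ioc, ← intervalIntegral.integral_of_le (by linarith),
      intervalIntegral.integral_const_mul, intervalIntegral.integral_sub (by simp)
        ((by fun_prop : Continuous fun t : ℝ => 2 * d * t).intervalIntegrable _ _),
      intervalIntegral.integral_const_mul]
    simp
    ring
  · exact (by fun_prop : Continuous fun t : ℝ => π * (d ^ 2 - 2 * d * t)).continuousOn
      |>.integrableOn_Icc
  · refine (ae_restrict_iff' measurableSet_Icc).2 (ae_of_all _ fun t ht => ?_)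
    have : 0 ≤ d ^ 2 - 2 * d * t := by nlinarith [ht.2]
    exact mul_nonneg pi_pos.le this

theorem half_ball_minus_ball_volume
    (x y : EuclideanSpace ℝ (Fin 3)) (r d : ℝ)
    (hd : d = ‖x - y‖) (hd0 : 0 < d) (hdr : d < r) :
    (volume {z : EuclideanSpace ℝ (Fin 3) |
        ‖z - x‖ ≤ r ∧ 0 ≤ ⟪z - x, y - x⟫ ∧ r < ‖z - y‖}).toReal
      = (1 / 4) * π * d ^ 3 := by
  have hr : 0 ≤ r := (hd0.trans hdr).le
  obtain ⟨b, hb⟩ : ∃ b : OrthonormalBasis (Fin 3) ℝ (EuclideanSpace ℝ (Fin 3)),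
      y - x = d • b 0 := by
    obtain ⟨b, hb⟩ := Orthonormal.exists_orthonormalBasis_extension_of_card_eq (𝕜 := ℝ)
      (E := EuclideanSpace ℝ (Fin 3)) (ι := Fin 3) (by simp)
      (v := fun _ => d⁻¹ • (y - x)) (s := {0}) (by
        constructor
        · rintro ⟨i, hi⟩
          rw [Set.domRestrict_apply, norm_smul, norm_sub_rev, ← hd, norm_inv,
            Real.norm_of_nonneg hd0.le, inv_mul_cancel₀ hd0.ne']
        · intro i j hij
          exact absurd (Subsingleton.elim i j) hij)
    exact ⟨b, by rw [hb 0 rfl, smul_inv_smul₀ hd0.ne']⟩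
  have hmp : MeasurePreserving (fun z : EuclideanSpace ℝ (Fin 3) =>
      MeasurableEquiv.piFinSuccAbove (fun _ => ℝ) 0 (WithLp.ofLp (b.repr (z - x)))) :=
    (volume_preserving_piFinSuccAbove (fun _ : Fin 3 => ℝ) 0).comp
      ((PiLp.volume_preserving_ofLp (Fin 3)).comp
        (b.repr.measurePreserving.comp (measurePreserving_sub_right volume x)))
  have hnorm (v : EuclideanSpace ℝ (Fin 3)) :
      ‖v‖ ^ 2 = b.repr v 0 ^ 2 + (b.repr v 1 ^ 2 + b.repr v 2 ^ 2) := by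
    rw [← b.repr.norm_map, EuclideanSpace.real_norm_sq_eq, Fin.sum_univ_three, add_assoc]
  have hset : {z : EuclideanSpace ℝ (Fin 3) |
        ‖z - x‖ ≤ r ∧ 0 ≤ ⟪z - x, y - x⟫ ∧ r < ‖z - y‖}
      = (fun z : EuclideanSpace ℝ (Fin 3) =>
          MeasurableEquiv.piFinSuccAbove (fun _ => ℝ) 0 (WithLp.ofLp (b.repr (z - x)))) ⁻¹'
        halfBallDiffBallCoord r d := by
    ext z
    have hzy : z - y = (z - x) - d • b 0 := by rw [← hb]; abel
    have hinner : ⟪z - x, y - x⟫ = d * b.repr (z - x) 0 := by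
      rw [hb, real_inner_smul_right, b.repr_apply_apply, real_inner_comm]
    rw [Set.mem_preimage, Set.mem_ofPred_eq, hinner, mul_nonneg_iff_of_pos_left hd0,
      ← sq_le_sq₀ (norm_nonneg _) hr, ← sq_lt_sq₀ hr (norm_nonneg _), hzy, hnorm, hnorm,
      map_sub b.repr (z - x), map_smul, b.repr_self]
    simp [halfBallDiffBallCoord, MeasurableEquiv.piFinSuccAbove, Fin.tail]
  rw [hset, hmp.measure_preimage (measurableSet_halfBallDiffBallCoord r d).nullMeasurableSet,
    volume_halfBallDiffBallCoord hd0 hdr, ENNReal.toReal_ofReal (by positivity)]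
end
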